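/- arXiv:1105.1505 — 2 statements merged into one kernel-verified Lean document; each statement's English description precedes it below -/
import Mathlib

section
/- Let F₁, …, F_r be finite-valued random variables jointly distributed with (X¹, X², Y¹, Y²) ∼ q such that the Markov chain Y¹ – (F₁,…,F_r, X¹, X²) – Y² holds, and let R'₁, …, R'_r be positive reals with Σ_{i=1}^s R'_i > I(Y¹, Y²; F₁,…,F_s | X¹, X²) for every 1 ≤ s ≤ r. Then every rate pair (R₁₂, R₂₁) with R₁₂ > H_q(X¹ | X²) + Σ_{i odd} R'_i and R₂₁ > H_q(X² | X¹) + Σ_{i even} R'_i is admissible for q with r + 2 interactive rounds of communication. -/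
open scoped BigOperators
open Finset

noncomputable section

namespace Coord

variable {Ω α β γ : Type*}

/-- `p` is a probability mass function on the finite type `α`. -/
def IsPMF [Fintype α] (p : α → ℝ) : Prop := (∀ a, 0 ≤ p a) ∧ ∑ a, p a = 1

/-- ℓ¹ (total variation) distance between two functions on a finite type. -/
def l1dist [Fintype α] (p q : α → ℝ) : ℝ := ∑ a, |p a - q a|

/-- The distribution (pushforward pmf) of the random variable `X` defined on the
finite sample space `Ω` carrying the pmf `μ`. -/
def distr [Fintype Ω] [DecidableEq α] (μ : Ω → ℝ) (X : Ω → α) : α → ℝ :=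
  fun a => ∑ ω, if X ω = a then μ ω else 0

/-- Shannon entropy (base 2) of a pmf. -/
def entFun [Fintype α] (p : α → ℝ) : ℝ := - ∑ a, p a * Real.logb 2 (p a)

/-- Shannon entropy `H(X)` of a random variable `X` on `(Ω, μ)`. -/
def H [Fintype Ω] [Fintype α] [DecidableEq α] (μ : Ω → ℝ) (X : Ω → α) : ℝ :=
  entFun (distr μ X)

/-- Conditional entropy `H(X | Z)`. -/
def condEnt [Fintype Ω] [Fintype α] [Fintype γ] [DecidableEq α] [DecidableEq γ]
    (μ : Ω → ℝ) (X : Ω → α) (Z : Ω → γ) : ℝ :=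
  H μ (fun ω => (X ω, Z ω)) - H μ Z

/-- Mutual information `I(X; Y)`. -/
def mi [Fintype Ω] [Fintype α] [Fintype β] [DecidableEq α] [DecidableEq β]
    (μ : Ω → ℝ) (X : Ω → α) (Y : Ω → β) : ℝ :=
  H μ X + H μ Y - H μ (fun ω => (X ω, Y ω))

/-- Conditional mutual information `I(X; Y | Z)`. -/
def cmi [Fintype Ω] [Fintype α] [Fintype β] [Fintype γ]
    [DecidableEq α] [DecidableEq β] [DecidableEq γ]
    (μ : Ω → ℝ) (X : Ω → α) (Y : Ω → β) (Z : Ω → γ) : ℝ :=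
  H μ (fun ω => (X ω, Z ω)) + H μ (fun ω => (Y ω, Z ω))
    - H μ (fun ω => (X ω, Y ω, Z ω)) - H μ Z

variable {𝒳₁ 𝒳₂ 𝒴₁ 𝒴₂ : Type}

/-- The `(x¹, x²)`-marginal of `q(x¹, x², y¹, y²)`. -/
def srcMarg [Fintype 𝒴₁] [Fintype 𝒴₂] (q : 𝒳₁ × 𝒳₂ × 𝒴₁ × 𝒴₂ → ℝ) :
    𝒳₁ × 𝒳₂ → ℝ := fun x => ∑ y₁, ∑ y₂, q (x.1, x.2, y₁, y₂)

/-- The rate pair `(R12, R21)` is admissible for the coordination problem `q` with `r`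
interactive rounds of communication: for every `ε > 0`, for all large enough block
lengths `n`, there is a finite probability space carrying the i.i.d. sources, private
randomness `M₁, M₂`, interactive messages `C i` (messages with even Lean-index,
i.e. odd 1-based index, are sent by the first node), and outputs `Y₁, Y₂`,
meeting the rate constraints and approximating the i.i.d. target distribution
within total variation `ε`. -/
def Admissible [Fintype 𝒳₁] [Fintype 𝒳₂] [Fintype 𝒴₁] [Fintype 𝒴₂]
    [DecidableEq 𝒳₁] [DecidableEq 𝒳₂] [DecidableEq 𝒴₁] [DecidableEq 𝒴₂]
    (q : 𝒳₁ × 𝒳₂ × 𝒴₁ × 𝒴₂ → ℝ) (r : ℕ) (R12 R21 : ℝ) : Prop :=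
  ∀ ε : ℝ, 0 < ε → ∃ n₀ : ℕ, ∀ n : ℕ, n₀ ≤ n →
    ∃ (Ω 𝓜₁ 𝓜₂ : Type) (𝓒 : Fin r → Type)
      (_ : Fintype Ω) (_ : DecidableEq Ω)
      (_ : Fintype 𝓜₁) (_ : DecidableEq 𝓜₁)
      (_ : Fintype 𝓜₂) (_ : DecidableEq 𝓜₂)
      (_ : ∀ i, Fintype (𝓒 i)) (_ : ∀ i, DecidableEq (𝓒 i))
      (μ : Ω → ℝ)
      (X₁ : Ω → Fin n → 𝒳₁) (X₂ : Ω → Fin n → 𝒳₂)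
      (M₁ : Ω → 𝓜₁) (M₂ : Ω → 𝓜₂)
      (C : (i : Fin r) → Ω → 𝓒 i)
      (Y₁ : Ω → Fin n → 𝒴₁) (Y₂ : Ω → Fin n → 𝒴₂),
      IsPMF μ ∧
      -- the source pairs are i.i.d. with per-letter distribution the (x¹,x²)-marginal of q
      (distr μ (fun ω => (X₁ ω, X₂ ω)) =
        fun x => ∏ k, srcMarg q (x.1 k, x.2 k)) ∧
      -- M₁, M₂ and the sources are mutually independent
      (distr μ (fun ω => (M₁ ω, M₂ ω, X₁ ω, X₂ ω)) =
        fun m => distr μ M₁ m.1 * distr μ M₂ m.2.1 *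
          distr μ (fun ω => (X₁ ω, X₂ ω)) m.2.2) ∧
      -- messages with odd 1-based index are functions of (previous messages, X¹, M₁)
      (∀ i : Fin r, (i : ℕ) % 2 = 0 →
        condEnt μ (C i)
          (fun ω => ((fun j : Fin (i : ℕ) => C ⟨j.1, j.2.trans i.2⟩ ω), X₁ ω, M₁ ω)) = 0) ∧
      -- messages with even 1-based index are functions of (previous messages, X², M₂)
      (∀ i : Fin r, (i : ℕ) % 2 = 1 →
        condEnt μ (C i)
          (fun ω => ((fun j : Fin (i : ℕ) => C ⟨j.1, j.2.trans i.2⟩ ω), X₂ ω, M₂ ω)) = 0) ∧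
      -- rate constraints
      (∑ i ∈ Finset.univ.filter (fun i : Fin r => (i : ℕ) % 2 = 0), H μ (C i)) ≤ n * R12 ∧
      (∑ i ∈ Finset.univ.filter (fun i : Fin r => (i : ℕ) % 2 = 1), H μ (C i)) ≤ n * R21 ∧
      -- the outputs are produced from the locally available information
      condEnt μ Y₁ (fun ω => (X₁ ω, M₁ ω, fun i : Fin r => C i ω)) = 0 ∧
      condEnt μ Y₂ (fun ω => (X₂ ω, M₂ ω, fun i : Fin r => C i ω)) = 0 ∧
      -- total variation distance to the i.i.d. target is at most ε
      l1dist (distr μ (fun ω => (X₁ ω, X₂ ω, Y₁ ω, Y₂ ω)))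
        (fun a => ∏ k, q (a.1 k, a.2.1 k, a.2.2.1 k, a.2.2.2 k)) ≤ ε

section ProductWeights

variable {ι : Type*} [Fintype ι] [DecidableEq ι] [Fintype α]

/-- The product weight on functions `ι → α` with coordinate weights `w i`. -/
def piWeight (w : ι → α → ℝ) (c : ι → α) : ℝ := ∏ i, w i (c i)

lemma sum_piWeight_eq_prod (w : ι → α → ℝ) : ∑ c, piWeight w c = ∏ i, ∑ a, w i a := by
  simp only [piWeight]
  rw [Finset.prod_univ_sum, Fintype.piFinset_univ]

lemma IsPMF.piWeight {w : ι → α → ℝ} (hw : ∀ i, IsPMF (w i)) : IsPMF (piWeight w) := by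
  refine ⟨fun c => Finset.prod_nonneg fun i _ => (hw i).1 _, ?_⟩
  rw [sum_piWeight_eq_prod]
  exact Finset.prod_eq_one fun i _ => (hw i).2

lemma sum_piWeight_mul {w : ι → α → ℝ} (hw : ∀ i, IsPMF (w i)) (i : ι) (g : α → ℝ) :
    ∑ c, piWeight w c * g (c i) = ∑ a, w i a * g a := by
  have h := sum_piWeight_eq_prod (fun l a => w l a * if l = i then g a else 1)
  have h1 : ∀ c : ι → α, piWeight (fun l a => w l a * if l = i then g a else 1) c =
      piWeight w c * g (c i) := by
    intro c
    simp only [piWeight, Finset.prod_mul_distrib, Finset.prod_ite_eq', Finset.mem_univ, if_true]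
  simp only [h1] at h
  rw [h, Finset.prod_eq_single i]
  · simp
  · intro l _ hl
    simp [hl, (hw l).2]
  · simp

lemma sum_piWeight_mul_mul {w : ι → α → ℝ} (hw : ∀ i, IsPMF (w i)) {i j : ι} (hij : i ≠ j)
    (g h : α → ℝ) :
    ∑ c, piWeight w c * (g (c i) * h (c j)) =
      (∑ a, w i a * g a) * ∑ a, w j a * h a := by
  have key := sum_piWeight_eq_prod
    (fun l a => w l a * ((if l = i then g a else 1) * (if l = j then h a else 1)))
  have h1 : ∀ c : ι → α, piWeight
      (fun l a => w l a * ((if l = i then g a else 1) * (if l = j then h a else 1))) c =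
      piWeight w c * (g (c i) * h (c j)) := by
    intro c
    simp only [piWeight, Finset.prod_mul_distrib, Finset.prod_ite_eq', Finset.mem_univ, if_true]
  simp only [h1] at key
  rw [key, ← Finset.prod_subset (Finset.subset_univ {i, j}), Finset.prod_pair hij]
  · simp [hij, hij.symm]
  · intro l _ hl
    simp only [Finset.mem_insert, Finset.mem_singleton, not_or] at hl
    simp [hl.1, hl.2, (hw l).2]

lemma sum_piWeight_sq_sum {w : α → ℝ} (hw : IsPMF w) {g : α → ℝ} (hg : ∑ a, w a * g a = 0) :
    ∑ c : ι → α, piWeight (fun _ => w) c * (∑ i, g (c i)) ^ 2 =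
      Fintype.card ι * ∑ a, w a * g a ^ 2 := by
  have h1 : ∀ c : ι → α, piWeight (fun _ => w) c * (∑ i, g (c i)) ^ 2 =
      ∑ i, ∑ j, piWeight (fun _ => w) c * (g (c i) * g (c j)) := by
    intro c
    rw [sq, Finset.sum_mul_sum, Finset.mul_sum]
    simp only [Finset.mul_sum]
  have h2 : ∀ i j : ι, ∑ c : ι → α, piWeight (fun _ => w) c * (g (c i) * g (c j)) =
      if i = j then ∑ a, w a * g a ^ 2 else 0 := by
    intro i j
    split_ifs with hij
    · subst hij
      rw [sum_piWeight_mul (fun _ => hw) i (fun a => g a * g a)]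
      simp only [sq]
    · rw [sum_piWeight_mul_mul (fun _ => hw) hij, hg, zero_mul]
  simp only [h1]
  rw [Finset.sum_comm]
  simp_rw [Finset.sum_comm (s := (Finset.univ : Finset (ι → α))), h2]
  simp

lemma IsPMF.exists_le {w : α → ℝ} (hw : IsPMF w) {φ : α → ℝ} {b : ℝ}
    (h : ∑ a, w a * φ a ≤ b) : ∃ a, φ a ≤ b := by
  by_contra! hc
  have h1 : ∑ a, w a * b ≤ ∑ a, w a * φ a :=
    Finset.sum_le_sum fun a _ => mul_le_mul_of_nonneg_left (hc a).le (hw.1 a)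
  have h2 : ∑ a, w a * (φ a - b) = 0 := by
    rw [← Finset.sum_mul, hw.2, one_mul] at h1
    simp only [mul_sub, Finset.sum_sub_distrib, ← Finset.sum_mul, hw.2, one_mul]
    linarith
  have h3 := (Finset.sum_eq_zero_iff_of_nonneg
    (fun a _ => mul_nonneg (hw.1 a) (sub_nonneg.2 (hc a).le))).1 h2
  have h4 : ∑ a, w a = 0 := Finset.sum_eq_zero fun a ha =>
    (mul_eq_zero.1 (h3 a ha)).resolve_right (sub_pos.2 (hc a)).ne'
  exact one_ne_zero (hw.2.symm.trans h4)

/-- Weak law of large numbers, upper tail. -/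
lemma weak_law {w : α → ℝ} (hw : IsPMF w) (g : α → ℝ) {t : ℝ} (ht : ∑ a, w a * g a < t)
    {ε : ℝ} (hε : 0 < ε) : ∃ n₀ : ℕ, ∀ n : ℕ, n₀ ≤ n →
      ∑ c : Fin n → α, piWeight (fun _ => w) c * (if n * t ≤ ∑ k, g (c k) then 1 else 0) ≤ ε := by
  set m := ∑ a, w a * g a with hm
  set V := ∑ a, w a * (g a - m) ^ 2 with hV
  have hV0 : 0 ≤ V := Finset.sum_nonneg fun a _ => mul_nonneg (hw.1 a) (sq_nonneg _)
  have hcent : ∑ a, w a * (g a - m) = 0 := by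
    simp only [mul_sub, Finset.sum_sub_distrib, ← Finset.sum_mul, hw.2, ← hm]
    ring
  have hd : 0 < t - m := sub_pos.2 ht
  obtain ⟨N, hN⟩ := exists_nat_gt (V / ((t - m) ^ 2 * ε))
  refine ⟨N + 1, fun n hn => ?_⟩
  have hn0 : (0 : ℝ) < n := by
    have : 0 < n := by omega
    exact_mod_cast this
  have hNn : (N : ℝ) ≤ n := by exact_mod_cast (by omega : N ≤ n)
  have hvar := sum_piWeight_sq_sum (ι := Fin n) hw hcent
  rw [Fintype.card_fin, ← hV] at hvar
  have hle : (n * (t - m)) ^ 2 * ∑ c : Fin n → α,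
      piWeight (fun _ => w) c * (if n * t ≤ ∑ k, g (c k) then 1 else 0) ≤ n * V := by
    rw [← hvar, Finset.mul_sum]
    refine Finset.sum_le_sum fun c _ => ?_
    have hc := (IsPMF.piWeight (ι := Fin n) (fun _ => hw)).1 c
    rw [mul_left_comm]
    refine mul_le_mul_of_nonneg_left ?_ hc
    split_ifs with h
    · rw [mul_one]
      refine pow_le_pow_left₀ (by positivity) ?_ 2
      simp only [Finset.sum_sub_distrib, Finset.sum_const, Finset.card_univ, Fintype.card_fin,
        nsmul_eq_mul]
      linarith
    · simpa using sq_nonneg _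
  have hpos : 0 < (n * (t - m)) ^ 2 := by positivity
  have h3 : V ≤ n * ((t - m) ^ 2 * ε) := by
    have := (div_lt_iff₀ (by positivity)).1 hN
    exact this.le.trans (mul_le_mul_of_nonneg_right hNn (by positivity))
  refine le_of_mul_le_mul_left (hle.trans ?_) hpos
  calc (n : ℝ) * V ≤ n * (n * ((t - m) ^ 2 * ε)) := by gcongr
    _ = _ := by ring

end ProductWeights

section OneShot

/-- The uniform pmf. -/
def unif (α : Type*) [Fintype α] : α → ℝ := fun _ => (Fintype.card α : ℝ)⁻¹

lemma isPMF_unif [Fintype α] [Nonempty α] : IsPMF (unif α) := by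
  refine ⟨fun _ => by unfold unif; positivity, ?_⟩
  simp [unif]

/-- Random binning with side information `s : β`: the source `a : α` is recovered from its
bin index and `s`, except with small probability. -/
lemma exists_binning [Fintype α] [Nonempty α] [DecidableEq α] [Fintype β] {P : α × β → ℝ}
    (hP : IsPMF P)
    (N : ℕ) [NeZero N] {τ : ℝ} (hτ : 0 ≤ τ) :
    ∃ (b : α → Fin N) (d : Fin N → β → α),
      ∑ z, P z * (if d (b z.1) z.2 ≠ z.1 then 1 else 0) ≤
        ∑ z, P z * (if τ * P z < ∑ a, P (a, z.2) then 1 else 0) + τ / N := by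
  classical
  set PB : β → ℝ := fun s => ∑ a, P (a, s) with hPB
  set T : α → β → Prop := fun a s => PB s ≤ τ * P (a, s) with hT
  have hPB1 : ∑ s, PB s = 1 := by
    rw [← hP.2, Fintype.sum_prod_type_right]
  -- `φ b` bounds the error probability of the typicality decoder for the binning `b`
  set φ : (α → Fin N) → ℝ := fun b => ∑ z : α × β, P z * ((if T z.1 z.2 then 0 else 1) +
    ∑ a, if a ≠ z.1 ∧ T a z.2 then (if b a = b z.1 then 1 else 0) else 0) with hφ
  have hmean : ∑ b, piWeight (fun _ : α => unif (Fin N)) b * φ b ≤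
      ∑ z, P z * (if τ * P z < ∑ a, P (a, z.2) then 1 else 0) + τ / N := by
    have hU : ∀ _ : α, IsPMF (unif (Fin N)) := fun _ => isPMF_unif
    have hcol : ∀ a a' : α, a ≠ a' → ∑ b, piWeight (fun _ : α => unif (Fin N)) b *
        (if b a = b a' then 1 else 0) = (N : ℝ)⁻¹ := by
      intro a a' haa
      have h1 : ∀ b : α → Fin N, (if b a = b a' then (1 : ℝ) else 0) =
          ∑ m, (if b a = m then 1 else 0) * (if b a' = m then 1 else 0) := by
        intro b
        simp [eq_comm]
      simp only [h1, Finset.mul_sum]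
      rw [Finset.sum_comm]
      simp_rw [fun m => sum_piWeight_mul_mul hU haa (fun x => if x = m then (1 : ℝ) else 0)
        (fun x => if x = m then (1 : ℝ) else 0)]
      have : (N : ℝ) ≠ 0 := NeZero.ne _
      simp [unif]
      field_simp
    have h2 : ∑ b, piWeight (fun _ : α => unif (Fin N)) b * φ b =
        ∑ z : α × β, P z * ((if T z.1 z.2 then 0 else 1) +
          ∑ a, if a ≠ z.1 ∧ T a z.2 then (N : ℝ)⁻¹ else 0) := by
      simp only [hφ, Finset.mul_sum]
      rw [Finset.sum_comm]
      refine Finset.sum_congr rfl fun z _ => ?_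
      simp only [mul_left_comm _ (P z)]
      rw [← Finset.mul_sum]
      congr 1
      simp only [mul_add, Finset.sum_add_distrib, ← Finset.sum_mul,
        (IsPMF.piWeight hU).2, one_mul, Finset.mul_sum]
      congr 1
      rw [Finset.sum_comm]
      refine Finset.sum_congr rfl fun a _ => ?_
      split_ifs with h
      · exact hcol a z.1 h.1
      · simp
    rw [h2]
    simp only [mul_add, Finset.sum_add_distrib]
    refine add_le_add (le_of_eq ?_) ?_
    · refine Finset.sum_congr rfl fun z _ => ?_
      congr 1
      by_cases h : PB z.2 ≤ τ * P z
      · rw [if_pos (show T z.1 z.2 from h), if_neg (not_lt.2 h)]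
      · rw [if_neg (show ¬ T z.1 z.2 from h), if_pos (not_le.1 h)]
    · have h3 : ∀ s, PB s * ∑ a, (if T a s then (N : ℝ)⁻¹ else 0) ≤ τ / N * PB s := by
        intro s
        have : τ / N * PB s = ∑ a, τ * P (a, s) * (N : ℝ)⁻¹ := by
          rw [← Finset.sum_mul, ← Finset.mul_sum]
          ring
        rw [this, Finset.mul_sum]
        refine Finset.sum_le_sum fun a _ => ?_
        split_ifs with h
        · exact mul_le_mul_of_nonneg_right h (by positivity)
        · rw [mul_zero]
          exact mul_nonneg (mul_nonneg hτ (hP.1 _)) (by positivity)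
      calc ∑ z : α × β, P z * ∑ a, (if a ≠ z.1 ∧ T a z.2 then (N : ℝ)⁻¹ else 0)
          ≤ ∑ z : α × β, P z * ∑ a, (if T a z.2 then (N : ℝ)⁻¹ else 0) := by
            refine Finset.sum_le_sum fun z _ => mul_le_mul_of_nonneg_left ?_ (hP.1 z)
            refine Finset.sum_le_sum fun a _ => ?_
            by_cases h1 : T a z.2
            · rw [if_pos h1]
              split_ifs
              exacts [le_rfl, by positivity]
            · simp [h1]
        _ = ∑ s, PB s * ∑ a, (if T a s then (N : ℝ)⁻¹ else 0) := by
            rw [Fintype.sum_prod_type_right]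
            simp only [hPB, Finset.sum_mul]
        _ ≤ ∑ s, τ / N * PB s := Finset.sum_le_sum fun s _ => h3 s
        _ = τ / N := by rw [← Finset.mul_sum, hPB1, mul_one]
  obtain ⟨b, hb⟩ := (IsPMF.piWeight fun _ => isPMF_unif).exists_le hmean
  refine ⟨b, fun m s => if h : ∃ a, T a s ∧ b a = m then h.choose else Classical.arbitrary α,
    le_trans ?_ hb⟩
  refine Finset.sum_le_sum fun z _ => mul_le_mul_of_nonneg_left ?_ (hP.1 z)
  have hnn : 0 ≤ ∑ a, (if a ≠ z.1 ∧ T a z.2 then (if b a = b z.1 then (1 : ℝ) else 0) else 0) :=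
    Finset.sum_nonneg fun a _ => by split_ifs <;> norm_num
  by_cases hz : T z.1 z.2
  · have hex : ∃ a, T a z.2 ∧ b a = b z.1 := ⟨z.1, hz, rfl⟩
    beta_reduce
    rw [dif_pos hex]
    split_ifs with hne
    · have hs := hex.choose_spec
      rw [zero_add]
      refine le_trans ?_ (Finset.single_le_sum (fun a _ => ?_) (Finset.mem_univ hex.choose))
      · rw [if_pos ⟨hne, hs.1⟩, if_pos hs.2]
      · split_ifs <;> norm_num
    · linarith
  · rw [if_neg hz]
    refine le_trans (b := (1 : ℝ)) ?_ (by linarith)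
    split_ifs <;> norm_num

lemma sum_mul_abs_le_sqrt [Fintype α] {w : α → ℝ} (hw : IsPMF w) (g : α → ℝ) :
    ∑ a, w a * |g a| ≤ √(∑ a, w a * g a ^ 2) := by
  refine Real.le_sqrt_of_sq_le ?_
  refine (Finset.sum_sq_le_sum_mul_sum_of_sq_le_mul _ (fun a _ => hw.1 a)
    (fun a _ => mul_nonneg (hw.1 a) (sq_nonneg (g a))) fun a _ => le_of_eq ?_).trans_eq ?_
  · rw [mul_pow, sq_abs]
    ring
  · rw [hw.2, one_mul]

/-- One-shot soft covering: a random codebook of size `K` simulates the output distribution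
of the channel `W` with input pmf `P`. -/
lemma exists_codebook {κ : Type*} [Fintype α] [Fintype β] [Fintype κ] [Nonempty κ] {P : α → ℝ}
    (hP : IsPMF P) {W : α → β → ℝ} (hW : ∀ a, IsPMF (W a)) {τ : ℝ} (hτ : 0 ≤ τ) :
    ∃ c : κ → α, ∑ y, |(Fintype.card κ : ℝ)⁻¹ * ∑ k, W (c k) y - ∑ a, P a * W a y| ≤
      2 * ∑ a, ∑ y, P a * W a y * (if τ * (∑ a', P a' * W a' y) < W a y then 1 else 0) +
        √(τ / Fintype.card κ) := by
  classical
  set M : ℝ := (Fintype.card κ : ℝ) with hM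
  have hM0 : 0 < M := by rw [hM]; exact_mod_cast Fintype.card_pos
  set Q : β → ℝ := fun y => ∑ a, P a * W a y with hQ
  have hQ0 : ∀ y, 0 ≤ Q y := fun y => Finset.sum_nonneg fun a _ => mul_nonneg (hP.1 a) ((hW a).1 y)
  have hQ1 : ∑ y, Q y = 1 := by
    simp only [hQ]
    rw [Finset.sum_comm]
    simp only [← Finset.mul_sum, (hW _).2, mul_one, hP.2]
  set Wa : α → β → ℝ := fun a y => if τ * Q y < W a y then W a y else 0 with hWa
  set Wt : α → β → ℝ := fun a y => if τ * Q y < W a y then 0 else W a y with hWt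
  have hsplit : ∀ a y, W a y = Wt a y + Wa a y := by
    intro a y
    simp only [hWt, hWa]
    split_ifs <;> simp
  have hWa0 : ∀ a y, 0 ≤ Wa a y := fun a y => by
    simp only [hWa]; split_ifs; exacts [(hW a).1 y, le_rfl]
  have hWt0 : ∀ a y, 0 ≤ Wt a y := fun a y => by
    simp only [hWt]; split_ifs; exacts [le_rfl, (hW a).1 y]
  have hWtW : ∀ a y, Wt a y ≤ W a y := fun a y => by
    have := hsplit a y; linarith [hWa0 a y]
  have hpi := IsPMF.piWeight (ι := κ) (fun _ => hP)
  have hone : ∀ (g : α → ℝ), ∑ c : κ → α, piWeight (fun _ => P) c * (M⁻¹ * ∑ k, g (c k)) =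
      ∑ a, P a * g a := by
    intro g
    simp only [Finset.mul_sum]
    rw [Finset.sum_comm]
    have : ∀ k : κ, ∑ c : κ → α, piWeight (fun _ => P) c * (M⁻¹ * g (c k)) =
        M⁻¹ * ∑ a, P a * g a := by
      intro k
      rw [← sum_piWeight_mul (fun _ => hP) k g, Finset.mul_sum]
      exact Finset.sum_congr rfl fun _ _ => by ring
    simp only [this, Finset.sum_const, Finset.card_univ, nsmul_eq_mul]
    rw [← hM, ← mul_assoc, mul_inv_cancel₀ hM0.ne', one_mul]
  have hvar : ∀ y, ∑ c : κ → α, piWeight (fun _ => P) c *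
      |M⁻¹ * ∑ k, Wt (c k) y - ∑ a, P a * Wt a y| ≤ √(τ / M) * Q y := by
    intro y
    set m := ∑ a, P a * Wt a y with hm
    refine (sum_mul_abs_le_sqrt hpi _).trans ?_
    have hcent : ∑ a, P a * (Wt a y - m) = 0 := by
      simp only [mul_sub, Finset.sum_sub_distrib, ← Finset.sum_mul, hP.2, one_mul, ← hm, sub_self]
    have h1 : ∑ c : κ → α, piWeight (fun _ => P) c * (M⁻¹ * ∑ k, Wt (c k) y - m) ^ 2 =
        M⁻¹ * ∑ a, P a * (Wt a y - m) ^ 2 := by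
      have h := sum_piWeight_sq_sum (ι := κ) hP hcent
      have h' : ∀ c : κ → α, piWeight (fun _ => P) c * (M⁻¹ * ∑ k, Wt (c k) y - m) ^ 2 =
          (M⁻¹) ^ 2 * (piWeight (fun _ => P) c * (∑ k, (Wt (c k) y - m)) ^ 2) := by
        intro c
        simp only [Finset.sum_sub_distrib, Finset.sum_const, Finset.card_univ, nsmul_eq_mul, ← hM]
        field_simp
      simp only [h']
      rw [← Finset.mul_sum, h, ← hM]
      field_simp
    have h2 : ∑ a, P a * (Wt a y - m) ^ 2 ≤ τ * Q y ^ 2 := by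
      have h3 : ∑ a, P a * (Wt a y - m) ^ 2 = ∑ a, P a * Wt a y ^ 2 - m ^ 2 := by
        have : ∀ a, P a * (Wt a y - m) ^ 2 =
            P a * Wt a y ^ 2 - 2 * m * (P a * Wt a y) + P a * m ^ 2 := fun a => by ring
        simp only [this, Finset.sum_add_distrib, Finset.sum_sub_distrib, ← Finset.mul_sum,
          ← Finset.sum_mul, hP.2, ← hm]
        ring
      rw [h3]
      have h4 : ∑ a, P a * Wt a y ^ 2 ≤ ∑ a, τ * Q y * (P a * W a y) := by
        refine Finset.sum_le_sum fun a _ => ?_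
        have h5 : Wt a y ≤ τ * Q y := by
          simp only [hWt]
          split_ifs with h
          · exact mul_nonneg hτ (hQ0 y)
          · exact not_lt.1 h
        calc P a * Wt a y ^ 2 = P a * (Wt a y * Wt a y) := by ring
          _ ≤ P a * ((τ * Q y) * W a y) := mul_le_mul_of_nonneg_left
              (mul_le_mul h5 (hWtW a y) (hWt0 a y) (mul_nonneg hτ (hQ0 y))) (hP.1 a)
          _ = _ := by ring
      rw [← Finset.mul_sum] at h4
      have h6 : ∑ a, P a * W a y = Q y := rfl
      rw [h6] at h4
      nlinarith [sq_nonneg m]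
    rw [h1]
    refine Real.sqrt_le_iff.2 ⟨mul_nonneg (Real.sqrt_nonneg _) (hQ0 y), ?_⟩
    rw [mul_pow, Real.sq_sqrt (by positivity)]
    calc M⁻¹ * ∑ a, P a * (Wt a y - m) ^ 2 ≤ M⁻¹ * (τ * Q y ^ 2) :=
          mul_le_mul_of_nonneg_left h2 (by positivity)
      _ = _ := by ring
  refine hpi.exists_le ?_
  have hpoint : ∀ c : κ → α, ∀ y, |M⁻¹ * ∑ k, W (c k) y - Q y| ≤
      |M⁻¹ * ∑ k, Wt (c k) y - ∑ a, P a * Wt a y| +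
        (M⁻¹ * ∑ k, Wa (c k) y + ∑ a, P a * Wa a y) := by
    intro c y
    have e1 : M⁻¹ * ∑ k, W (c k) y - Q y = (M⁻¹ * ∑ k, Wt (c k) y - ∑ a, P a * Wt a y) +
        (M⁻¹ * ∑ k, Wa (c k) y - ∑ a, P a * Wa a y) := by
      simp only [hQ, hsplit, Finset.sum_add_distrib, mul_add]
      ring
    rw [e1]
    refine (abs_add_le _ _).trans (add_le_add le_rfl ?_)
    refine (abs_sub _ _).trans_eq ?_
    rw [abs_of_nonneg, abs_of_nonneg]
    · exact Finset.sum_nonneg fun a _ => mul_nonneg (hP.1 a) (hWa0 a y)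
    · exact mul_nonneg (by positivity) (Finset.sum_nonneg fun k _ => hWa0 _ y)
  have hWa' : ∀ a y, P a * W a y * (if τ * Q y < W a y then 1 else 0) = P a * Wa a y := by
    intro a y
    simp only [hWa]
    split_ifs <;> simp
  have hA : ∑ a, ∑ y, P a * W a y * (if τ * Q y < W a y then 1 else 0) =
      ∑ y, ∑ a, P a * Wa a y := by
    simp only [hWa']
    rw [Finset.sum_comm]
  rw [hA]
  calc ∑ c : κ → α, piWeight (fun _ => P) c * ∑ y, |M⁻¹ * ∑ k, W (c k) y - Q y|
      ≤ ∑ c : κ → α, piWeight (fun _ => P) c * ∑ y,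
        (|M⁻¹ * ∑ k, Wt (c k) y - ∑ a, P a * Wt a y| +
          (M⁻¹ * ∑ k, Wa (c k) y + ∑ a, P a * Wa a y)) :=
        Finset.sum_le_sum fun c _ => mul_le_mul_of_nonneg_left
          (Finset.sum_le_sum fun y _ => hpoint c y) (hpi.1 c)
    _ = ∑ y, (∑ c : κ → α, piWeight (fun _ => P) c *
          |M⁻¹ * ∑ k, Wt (c k) y - ∑ a, P a * Wt a y| +
          (∑ a, P a * Wa a y + ∑ a, P a * Wa a y)) := by
        simp only [Finset.mul_sum (Finset.univ : Finset β)]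
        rw [Finset.sum_comm]
        refine Finset.sum_congr rfl fun y _ => ?_
        simp only [mul_add (piWeight _ _), Finset.sum_add_distrib, hone (fun a => Wa a y)]
        simp only [← Finset.sum_mul, hpi.2, one_mul]
    _ ≤ ∑ y, (√(τ / M) * Q y + (∑ a, P a * Wa a y + ∑ a, P a * Wa a y)) :=
        Finset.sum_le_sum fun y _ => add_le_add (hvar y) le_rfl
    _ = _ := by
        rw [Finset.sum_add_distrib, ← Finset.mul_sum, hQ1, Finset.sum_add_distrib]
        ring

end OneShot

section Block

lemma sum_arrow_prod {ι M : Type*} [Fintype ι] [DecidableEq ι] [Fintype α] [Fintype β]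
    [AddCommMonoid M] (G : (ι → α × β) → M) :
    ∑ c, G c = ∑ x : ι → α, ∑ s : ι → β, G fun k => (x k, s k) := by
  rw [← Fintype.sum_prod_type' (f := fun (x : ι → α) (s : ι → β) => G fun k => (x k, s k))]
  exact Fintype.sum_equiv (Equiv.arrowProdEquivProdArrow ι (fun _ => α) (fun _ => β)) _ _
    fun c => rfl

lemma le_sum_logb_sub {ι : Type*} [Fintype ι] {a b : ι → ℝ} (ha : ∀ i, 0 < a i)
    (hb : ∀ i, 0 < b i) {T : ℝ} (h : (2 : ℝ) ^ T * ∏ i, a i < ∏ i, b i) :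
    T ≤ ∑ i, (Real.logb 2 (b i) - Real.logb 2 (a i)) := by
  have ha' : 0 < ∏ i, a i := Finset.prod_pos fun i _ => ha i
  have h2 : (0 : ℝ) < 2 ^ T := by positivity
  have h1 := (Real.logb_lt_logb_iff one_lt_two (mul_pos h2 ha') (h.trans' (mul_pos h2 ha'))).2 h
  rw [Real.logb_mul h2.ne' ha'.ne', Real.logb_rpow two_pos (by norm_num),
    Real.logb_prod _ _ fun i _ => (ha i).ne', Real.logb_prod _ _ fun i _ => (hb i).ne'] at h1
  rw [Finset.sum_sub_distrib]
  linarith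

lemma exists_two_rpow_le {s t : ℝ} (hst : s < t) {ε : ℝ} (hε : 0 < ε) :
    ∃ n₀ : ℕ, ∀ n : ℕ, n₀ ≤ n → ∀ N : ℝ, (2 : ℝ) ^ (n * t) ≤ N → (2 : ℝ) ^ (n * s) / N ≤ ε := by
  have hx0 : (0 : ℝ) < 2 ^ (s - t) := by positivity
  have hx1 : (2 : ℝ) ^ (s - t) < 1 :=
    Real.rpow_lt_one_of_one_lt_of_neg one_lt_two (by linarith)
  obtain ⟨n₀, hn₀⟩ := Filter.eventually_atTop.1
    ((tendsto_pow_atTop_nhds_zero_of_lt_one hx0.le hx1).eventually (ge_mem_nhds hε))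
  refine ⟨n₀, fun n hn N hN => ?_⟩
  have hp : (0 : ℝ) < 2 ^ (n * t) := by positivity
  calc (2 : ℝ) ^ (n * s) / N ≤ 2 ^ (n * s) / 2 ^ (n * t) := by gcongr
    _ = (2 ^ (s - t)) ^ n := by
      rw [← Real.rpow_sub two_pos, ← Real.rpow_natCast, ← Real.rpow_mul two_pos.le]
      congr 1
      ring
    _ ≤ ε := hn₀ n hn

/-- Source coding with side information at the decoder. -/
lemma exists_block_binning [Fintype α] [Nonempty α] [DecidableEq α] [Fintype β] {P : α × β → ℝ}
    (hP : IsPMF P) {t : ℝ}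
    (ht : ∑ z, P z * (Real.logb 2 (∑ a, P (a, z.2)) - Real.logb 2 (P z)) < t)
    {ε : ℝ} (hε : 0 < ε) :
    ∃ n₀ : ℕ, ∀ n : ℕ, n₀ ≤ n → ∀ (N : ℕ) [NeZero N], (2 : ℝ) ^ (n * t) ≤ N →
      ∃ (b : (Fin n → α) → Fin N) (d : Fin N → (Fin n → β) → Fin n → α),
        ∑ x : Fin n → α, ∑ s : Fin n → β,
          (∏ k, P (x k, s k)) * (if d (b x) s ≠ x then 1 else 0) ≤ ε := by
  obtain ⟨t', ht1, ht2⟩ := exists_between ht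
  obtain ⟨n₁, hn₁⟩ := weak_law hP
    (fun z => Real.logb 2 (∑ a, P (a, z.2)) - Real.logb 2 (P z)) ht1 (half_pos hε)
  obtain ⟨n₂, hn₂⟩ := exists_two_rpow_le ht2 (half_pos hε)
  refine ⟨max n₁ n₂, fun n hn N _ hN => ?_⟩
  have h1 := hn₁ n (le_of_max_le_left hn)
  have h2 := hn₂ n (le_of_max_le_right hn) N hN
  set P' : (Fin n → α) × (Fin n → β) → ℝ := fun z => ∏ k, P (z.1 k, z.2 k) with hP'
  have hpi := IsPMF.piWeight (ι := Fin n) fun _ => hP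
  have hP'pmf : IsPMF P' := by
    refine ⟨fun z => Finset.prod_nonneg fun k _ => hP.1 _, ?_⟩
    rw [← hpi.2, sum_arrow_prod, Fintype.sum_prod_type]
    rfl
  obtain ⟨b, d, hbd⟩ := exists_binning hP'pmf N (τ := 2 ^ (n * t')) (by positivity)
  refine ⟨b, d, ?_⟩
  rw [Fintype.sum_prod_type] at hbd
  refine hbd.trans ((add_le_add (le_trans ?_ h1) h2).trans (add_halves ε).le)
  rw [sum_arrow_prod, Fintype.sum_prod_type]
  refine Finset.sum_le_sum fun x _ => Finset.sum_le_sum fun s _ => ?_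
  change (∏ k, P (x k, s k)) * _ ≤ (∏ k, P (x k, s k)) * _
  by_cases hz : ∃ k, P (x k, s k) = 0
  · obtain ⟨k, hk⟩ := hz
    rw [Finset.prod_eq_zero (Finset.mem_univ k) hk, zero_mul, zero_mul]
  push Not at hz
  have hpos : ∀ k, 0 < P (x k, s k) := fun k => lt_of_le_of_ne (hP.1 _) (hz k).symm
  refine mul_le_mul_of_nonneg_left ?_ (Finset.prod_nonneg fun k _ => hP.1 _)
  have hmarg : ∑ a, P' (a, s) = ∏ k, ∑ a, P (a, s k) :=
    sum_piWeight_eq_prod fun k a => P (a, s k)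
  split_ifs with h3 h4
  · exact le_rfl
  · refine absurd ?_ h4
    change 2 ^ (n * t') * ∏ k, P (x k, s k) < ∑ a, P' (a, s) at h3
    rw [hmarg] at h3
    exact le_sum_logb_sub hpos (fun k => (hpos k).trans_le
      (Finset.single_le_sum (f := fun a => P (a, s k)) (fun a _ => hP.1 _)
        (Finset.mem_univ (x k)))) h3
  · exact zero_le_one
  · exact le_rfl

/-- Conditional soft covering: given the i.i.d. sequence `x`, a codebook of rate larger than
the conditional mutual information simulates the memoryless channel `x ↦ y`. -/
lemma exists_block_codebook {ξ φ υ : Type*} [Fintype ξ] [Fintype φ] [Fintype υ] {S : ξ → ℝ}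
    (hS : IsPMF S) {V : ξ → φ → ℝ} (hV : ∀ x, IsPMF (V x)) {W : φ → ξ → υ → ℝ}
    (hW : ∀ f x, IsPMF (W f x)) {t : ℝ}
    (ht : ∑ z : ξ × φ × υ, S z.1 * V z.1 z.2.1 * W z.2.1 z.1 z.2.2 *
      (Real.logb 2 (W z.2.1 z.1 z.2.2) -
        Real.logb 2 (∑ f, V z.1 f * W f z.1 z.2.2)) < t)
    {ε : ℝ} (hε : 0 < ε) :
    ∃ n₀ : ℕ, ∀ n : ℕ, n₀ ≤ n → ∀ (κ : Type) [Fintype κ] [Nonempty κ],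
      (2 : ℝ) ^ (n * t) ≤ Fintype.card κ →
      ∃ c : (Fin n → ξ) → κ → Fin n → φ,
        ∑ x : Fin n → ξ, (∏ j, S (x j)) * ∑ y : Fin n → υ,
          |(Fintype.card κ : ℝ)⁻¹ * ∑ k, ∏ j, W (c x k j) (x j) (y j) -
            ∏ j, ∑ f, V (x j) f * W f (x j) (y j)| ≤ ε := by
  classical
  obtain ⟨t', ht1, ht2⟩ := exists_between ht
  set w : ξ × φ × υ → ℝ := fun z => S z.1 * V z.1 z.2.1 * W z.2.1 z.1 z.2.2 with hw
  have hw0 : ∀ z, 0 ≤ w z := fun z =>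
    mul_nonneg (mul_nonneg (hS.1 _) ((hV _).1 _)) ((hW _ _).1 _)
  have hwpmf : IsPMF w := by
    refine ⟨hw0, ?_⟩
    simp only [hw, Fintype.sum_prod_type, ← Finset.mul_sum, (hW _ _).2, mul_one, (hV _).2, hS.2]
  obtain ⟨n₁, hn₁⟩ := weak_law hwpmf _ ht1 (ε := ε / 4) (by positivity)
  obtain ⟨n₂, hn₂⟩ := exists_two_rpow_le ht2 (ε := (ε / 2) ^ 2) (by positivity)
  refine ⟨max n₁ n₂, fun n hn κ _ _ hκ => ?_⟩
  have h1 := hn₁ n (le_of_max_le_left hn)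
  have h2 := hn₂ n (le_of_max_le_right hn) _ hκ
  have hone : ∀ x : Fin n → ξ, _ := fun x => exists_codebook (κ := κ)
    (IsPMF.piWeight fun j => hV (x j))
    (W := fun a => piWeight fun j => W (a j) (x j))
    (fun a => IsPMF.piWeight fun j => hW (a j) (x j)) (τ := 2 ^ (n * t')) (by positivity)
  choose c hc using hone
  refine ⟨c, ?_⟩
  have hQ : ∀ (x : Fin n → ξ) (y : Fin n → υ), ∑ a : Fin n → φ, (piWeight fun j => V (x j)) a *
      (piWeight fun j => W (a j) (x j)) y = ∏ j, ∑ f, V (x j) f * W f (x j) (y j) := by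
    intro x y
    rw [← sum_piWeight_eq_prod]
    simp only [piWeight, Finset.prod_mul_distrib]
  simp only [hQ] at hc
  have hSpmf := IsPMF.piWeight (ι := Fin n) fun _ => hS
  have hsq : √((2 : ℝ) ^ (n * t') / Fintype.card κ) ≤ ε / 2 :=
    Real.sqrt_le_iff.2 ⟨by positivity, h2⟩
  refine (Finset.sum_le_sum fun x _ => mul_le_mul_of_nonneg_left
    ((hc x).trans (add_le_add le_rfl hsq)) (hSpmf.1 x)).trans ?_
  simp only [mul_add, Finset.sum_add_distrib, ← Finset.sum_mul, hSpmf.2, one_mul]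
  have h3 : ∑ x : Fin n → ξ, piWeight (fun _ => S) x * ∑ a : Fin n → φ, ∑ y : Fin n → υ,
      (piWeight fun j => V (x j)) a * (piWeight fun j => W (a j) (x j)) y *
      (if 2 ^ (n * t') * (∏ j, ∑ f, V (x j) f * W f (x j) (y j)) <
        (piWeight fun j => W (a j) (x j)) y then 1 else 0) ≤ ε / 4 := by
    refine le_trans ?_ h1
    rw [sum_arrow_prod]
    simp only [sum_arrow_prod (α := φ), Finset.mul_sum]
    refine Finset.sum_le_sum fun x _ => Finset.sum_le_sum fun a _ =>
      Finset.sum_le_sum fun y _ => ?_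
    have hprod : piWeight (fun _ => w) (fun k => (x k, a k, y k)) = (∏ j, S (x j)) *
        (∏ j, V (x j) (a j)) * ∏ j, W (a j) (x j) (y j) := by
      simp only [piWeight, hw, Finset.prod_mul_distrib]
    rw [hprod, ← mul_assoc, ← mul_assoc]
    by_cases hz : ∃ k, w (x k, a k, y k) = 0
    · obtain ⟨k, hk⟩ := hz
      have h0 : (∏ j, S (x j)) * (∏ j, V (x j) (a j)) * ∏ j, W (a j) (x j) (y j) = 0 := by
        rw [← hprod]
        exact Finset.prod_eq_zero (Finset.mem_univ k) hk
      change (∏ j, S (x j)) * (∏ j, V (x j) (a j)) * (∏ j, W (a j) (x j) (y j)) * _ ≤ _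
      rw [h0, zero_mul, zero_mul]
    push Not at hz
    refine mul_le_mul_of_nonneg_left ?_ ?_
    · have hV0 : ∀ k, V (x k) (a k) ≠ 0 := fun k h => hz k (by simp [hw, h])
      have hW0 : ∀ k, W (a k) (x k) (y k) ≠ 0 := fun k h => hz k (by simp [hw, h])
      have hVp : ∀ k, 0 < V (x k) (a k) := fun k => ((hV _).1 _).lt_of_ne (hV0 k).symm
      have hWp : ∀ k, 0 < W (a k) (x k) (y k) := fun k => ((hW _ _).1 _).lt_of_ne (hW0 k).symm
      split_ifs with h4 h5
      · exact le_rfl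
      · refine absurd ?_ h5
        exact le_sum_logb_sub (fun k => (mul_pos (hVp k) (hWp k)).trans_le
          (Finset.single_le_sum (f := fun f => V (x k) f * W f (x k) (y k))
            (fun f _ => mul_nonneg ((hV _).1 _) ((hW _ _).1 _)) (Finset.mem_univ (a k)))) hWp h4
      · exact zero_le_one
      · exact le_rfl
    · have h6 := (IsPMF.piWeight (ι := Fin n) fun _ => hwpmf).1 fun k => (x k, a k, y k)
      rw [hprod] at h6
      exact h6
  simp only [mul_left_comm _ (2 : ℝ), ← Finset.mul_sum] at h3 ⊢
  linarith

end Block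

section Entropy

lemma eq_of_sum_mul_logb_eq_zero [Fintype α] {P Q : α → ℝ} (hP : IsPMF P) (hQ : IsPMF Q)
    (hPQ : ∀ a, Q a = 0 → P a = 0)
    (h : ∑ a, P a * (Real.logb 2 (P a) - Real.logb 2 (Q a)) = 0) : P = Q := by
  have hlog : Real.log 2 ≠ 0 := (Real.log_pos one_lt_two).ne'
  have h' : ∑ a, P a * (Real.log (P a) - Real.log (Q a)) = 0 := by
    have : ∑ a, P a * (Real.log (P a) - Real.log (Q a)) =
        Real.log 2 * ∑ a, P a * (Real.logb 2 (P a) - Real.logb 2 (Q a)) := by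
      rw [Finset.mul_sum]
      refine Finset.sum_congr rfl fun a _ => ?_
      simp only [Real.logb]
      field_simp
    rw [this, h, mul_zero]
  have hterm : ∀ a, Q a * InformationTheory.klFun (P a / Q a) =
      P a * (Real.log (P a) - Real.log (Q a)) + Q a - P a := by
    intro a
    by_cases hq : Q a = 0
    · simp [hq, hPQ a hq]
    by_cases hp : P a = 0
    · simp [hp, InformationTheory.klFun]
    · rw [InformationTheory.klFun, Real.log_div hp hq]
      field_simp
  have hsum : ∑ a, Q a * InformationTheory.klFun (P a / Q a) = 0 := by
    simp only [hterm, Finset.sum_sub_distrib, Finset.sum_add_distrib, h', hP.2, hQ.2]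
    norm_num
  have hnn : ∀ a, 0 ≤ P a / Q a := fun a => div_nonneg (hP.1 a) (hQ.1 a)
  rw [Finset.sum_eq_zero_iff_of_nonneg fun a _ =>
    mul_nonneg (hQ.1 a) (InformationTheory.klFun_nonneg (hnn a))] at hsum
  funext a
  rcases mul_eq_zero.1 (hsum a (Finset.mem_univ a)) with h1 | h1
  · rw [h1, hPQ a h1]
  · have h2 := (InformationTheory.klFun_eq_zero_iff (hnn a)).1 h1
    exact eq_of_div_eq_one h2

lemma exists_kernel [Fintype β] [Nonempty β] {P : α → β → ℝ} (hP : ∀ a b, 0 ≤ P a b) :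
    ∃ W : α → β → ℝ, (∀ a, IsPMF (W a)) ∧ ∀ a b, P a b = (∑ b', P a b') * W a b := by
  classical
  refine ⟨fun a b => if ∑ b', P a b' = 0 then (if b = Classical.arbitrary β then 1 else 0)
    else P a b / ∑ b', P a b', fun a => ⟨fun b => ?_, ?_⟩, fun a b => ?_⟩
  · beta_reduce
    split_ifs
    · exact zero_le_one
    · exact le_rfl
    · exact div_nonneg (hP a b) (Finset.sum_nonneg fun b _ => hP a b)
  · beta_reduce
    split_ifs with h
    · simp
    · rw [← Finset.sum_div, div_self h]
  · beta_reduce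
    split_ifs with h h'
    · rw [h, zero_mul]
      exact (Finset.sum_eq_zero_iff_of_nonneg fun b _ => hP a b).1 h b (Finset.mem_univ b)
    · rw [h, zero_mul]
      exact (Finset.sum_eq_zero_iff_of_nonneg fun b _ => hP a b).1 h b (Finset.mem_univ b)
    · field_simp

variable [Fintype Ω] [DecidableEq α] [DecidableEq β] [DecidableEq γ]

lemma sum_distr_mul [Fintype α] (μ : Ω → ℝ) (X : Ω → α) (g : α → ℝ) :
    ∑ a, distr μ X a * g a = ∑ ω, μ ω * g (X ω) := by
  simp only [distr, Finset.sum_mul, ite_mul, zero_mul]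
  rw [Finset.sum_comm]
  simp

lemma sum_distr [Fintype α] (μ : Ω → ℝ) (X : Ω → α) : ∑ a, distr μ X a = ∑ ω, μ ω := by
  simpa using sum_distr_mul μ X fun _ => 1

lemma distr_nonneg {μ : Ω → ℝ} (hμ : ∀ ω, 0 ≤ μ ω) (X : Ω → α) (a : α) : 0 ≤ distr μ X a :=
  Finset.sum_nonneg fun ω _ => by split_ifs; exacts [hμ ω, le_rfl]

lemma IsPMF.distr [Fintype α] {μ : Ω → ℝ} (hμ : IsPMF μ) (X : Ω → α) : IsPMF (distr μ X) :=
  ⟨distr_nonneg hμ.1 X, (sum_distr μ X).trans hμ.2⟩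

lemma distr_comp_injective (μ : Ω → ℝ) (X : Ω → α) {f : α → β} (hf : Function.Injective f)
    (a : α) : distr μ (fun ω => f (X ω)) (f a) = distr μ X a := by
  simp only [distr, hf.eq_iff]

lemma le_distr {μ : Ω → ℝ} (hμ : ∀ ω, 0 ≤ μ ω) (X : Ω → α) (ω : Ω) :
    μ ω ≤ distr μ X (X ω) := by
  have := Finset.single_le_sum (f := fun ω' => if X ω' = X ω then μ ω' else 0)
    (fun ω' _ => by split_ifs; exacts [hμ ω', le_rfl]) (Finset.mem_univ ω)
  simpa [distr] using this

/-- The value of a law when the sample space splits as a product. -/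
lemma distr_eq_sum_of_equiv {δ : Type*} [Fintype α] [Fintype δ] (μ : Ω → ℝ) (X : Ω → α)
    (e : Ω ≃ α × δ)
    (hX : ∀ ω, X ω = (e ω).1) (a : α) : distr μ X a = ∑ b, μ (e.symm (a, b)) := by
  simp only [distr, hX]
  rw [← e.symm.sum_comp, Fintype.sum_prod_type_right]
  simp

lemma H_eq_sum [Fintype α] (μ : Ω → ℝ) (X : Ω → α) :
    H μ X = -∑ ω, μ ω * Real.logb 2 (distr μ X (X ω)) := by
  rw [H, entFun, sum_distr_mul]

lemma H_comp_injective [Fintype α] [Fintype β] (μ : Ω → ℝ) (X : Ω → α) {f : α → β}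
    (hf : Function.Injective f) : H μ (fun ω => f (X ω)) = H μ X := by
  simp only [H_eq_sum, distr_comp_injective μ X hf]

lemma condEnt_eq_zero_of_eq [Fintype α] [Fintype γ] (μ : Ω → ℝ) (X : Ω → α) (Z : Ω → γ)
    (g : γ → α) (h : ∀ ω, X ω = g (Z ω)) : condEnt μ X Z = 0 := by
  have hf : Function.Injective fun z : γ => (g z, z) := fun z z' hz => (Prod.ext_iff.1 hz).2
  simp only [condEnt, h]
  rw [H_comp_injective μ Z hf, sub_self]

lemma H_const [Fintype α] {μ : Ω → ℝ} (hμ : IsPMF μ) (a : α) : H μ (fun _ => a) = 0 := by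
  simp [H_eq_sum, distr, hμ.2]

lemma H_le_logb_card [Fintype α] {μ : Ω → ℝ} (hμ : IsPMF μ) (X : Ω → α) :
    H μ X ≤ Real.logb 2 (Fintype.card α) := by
  have hp := hμ.distr X
  set p := distr μ X with hpdef
  have hne : Nonempty α := by
    by_contra hc
    rw [not_nonempty_iff] at hc
    have := hp.2
    simp at this
  set m : ℝ := (Fintype.card α : ℝ) with hm
  have hm0 : 0 < m := by rw [hm]; exact_mod_cast Fintype.card_pos
  have hterm : ∀ a, -(p a * Real.log (p a)) ≤ p a * Real.log m + (m⁻¹ - p a) := by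
    intro a
    rcases (hp.1 a).eq_or_lt with h0 | h0
    · simp [← h0, hm0.le]
    · have h1 := Real.log_le_sub_one_of_pos (show 0 < (p a * m)⁻¹ by positivity)
      rw [Real.log_inv, Real.log_mul h0.ne' hm0.ne'] at h1
      have h2 := mul_le_mul_of_nonneg_left h1 h0.le
      have h3 : p a * ((p a * m)⁻¹ - 1) = m⁻¹ - p a := by field_simp
      rw [h3] at h2
      linarith
  have hsum := Finset.sum_le_sum fun a (_ : a ∈ Finset.univ) => hterm a
  rw [Finset.sum_add_distrib, Finset.sum_sub_distrib, ← Finset.sum_mul, hp.2, one_mul] at hsum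
  simp only [Finset.sum_const, Finset.card_univ, nsmul_eq_mul, ← hm,
    mul_inv_cancel₀ hm0.ne', sub_self, add_zero, Finset.sum_neg_distrib] at hsum
  have hlog : 0 < Real.log 2 := Real.log_pos one_lt_two
  rw [H, ← hpdef, entFun]
  simp only [Real.logb, mul_div_assoc']
  rw [← Finset.sum_div, ← neg_div]
  exact div_le_div_of_nonneg_right hsum hlog.le

lemma cmi_eq_sum [Fintype α] [Fintype β] [Fintype γ] (μ : Ω → ℝ) (X : Ω → α) (Y : Ω → β)
    (Z : Ω → γ) :
    cmi μ X Y Z = ∑ ω, μ ω * (Real.logb 2 (distr μ (fun ω => (X ω, Y ω, Z ω)) (X ω, Y ω, Z ω)) +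
      Real.logb 2 (distr μ Z (Z ω)) - Real.logb 2 (distr μ (fun ω => (X ω, Z ω)) (X ω, Z ω)) -
      Real.logb 2 (distr μ (fun ω => (Y ω, Z ω)) (Y ω, Z ω))) := by
  simp only [cmi, H_eq_sum, mul_sub, mul_add, Finset.sum_sub_distrib, Finset.sum_add_distrib]
  ring

/-- Vanishing conditional mutual information gives the Markov factorization. -/
lemma distr_mul_distr_of_cmi_eq_zero [Fintype α] [Fintype β] [Fintype γ] {μ : Ω → ℝ}
    (hμ : IsPMF μ) (X : Ω → α) (Y : Ω → β) (Z : Ω → γ) (h : cmi μ X Y Z = 0) (a : α) (b : β)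
    (c : γ) :
    distr μ (fun ω => (X ω, Y ω, Z ω)) (a, b, c) * distr μ Z c =
      distr μ (fun ω => (X ω, Z ω)) (a, c) * distr μ (fun ω => (Y ω, Z ω)) (b, c) := by
  set dXYZ := distr μ (fun ω => (X ω, Y ω, Z ω)) with hXYZ
  set dXZ := distr μ (fun ω => (X ω, Z ω)) with hXZ
  set dYZ := distr μ (fun ω => (Y ω, Z ω)) with hYZ
  set dZ := distr μ Z with hZ
  have pXYZ : IsPMF dXYZ := hμ.distr _
  have pXZ : IsPMF dXZ := hμ.distr _
  have pYZ : IsPMF dYZ := hμ.distr _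
  have pZ : IsPMF dZ := hμ.distr _
  have mX : ∀ c, ∑ a, dXZ (a, c) = dZ c := by
    intro c
    simp only [hXZ, hZ, distr, Prod.mk.injEq]
    rw [Finset.sum_comm]
    simp [ite_and]
  have mY : ∀ c, ∑ b, dYZ (b, c) = dZ c := by
    intro c
    simp only [hYZ, hZ, distr, Prod.mk.injEq]
    rw [Finset.sum_comm]
    simp [ite_and]
  have mXY : ∀ a c, ∑ b, dXYZ (a, b, c) = dXZ (a, c) := by
    intro a c
    simp only [hXYZ, hXZ, distr, Prod.mk.injEq]
    rw [Finset.sum_comm]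
    simp [ite_and]
  have mYX : ∀ b c, ∑ a, dXYZ (a, b, c) = dYZ (b, c) := by
    intro b c
    simp only [hXYZ, hYZ, distr, Prod.mk.injEq]
    rw [Finset.sum_comm]
    simp [ite_and]
  have zX : ∀ a c, dZ c = 0 → dXZ (a, c) = 0 := fun a c h0 =>
    (Finset.sum_eq_zero_iff_of_nonneg (fun a _ => pXZ.1 (a, c))).1 ((mX c).trans h0) a
      (Finset.mem_univ a)
  have zXY : ∀ a b c, dXZ (a, c) = 0 → dXYZ (a, b, c) = 0 := fun a b c h0 =>
    (Finset.sum_eq_zero_iff_of_nonneg (fun b _ => pXYZ.1 (a, b, c))).1 ((mXY a c).trans h0) b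
      (Finset.mem_univ b)
  have zYX : ∀ a b c, dYZ (b, c) = 0 → dXYZ (a, b, c) = 0 := fun a b c h0 =>
    (Finset.sum_eq_zero_iff_of_nonneg (fun a _ => pXYZ.1 (a, b, c))).1 ((mYX b c).trans h0) a
      (Finset.mem_univ a)
  set Q : α × β × γ → ℝ := fun z => dXZ (z.1, z.2.2) * dYZ (z.2.1, z.2.2) / dZ z.2.2 with hQdef
  have pQ : IsPMF Q := by
    refine ⟨fun z => div_nonneg (mul_nonneg (pXZ.1 _) (pYZ.1 _)) (pZ.1 _), ?_⟩
    simp only [hQdef, Fintype.sum_prod_type]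
    have h1 : ∀ a, ∑ b, ∑ c, dXZ (a, c) * dYZ (b, c) / dZ c = ∑ c, dXZ (a, c) := by
      intro a
      rw [Finset.sum_comm]
      refine Finset.sum_congr rfl fun c _ => ?_
      rw [← Finset.sum_div, ← Finset.mul_sum, mY]
      by_cases h0 : dZ c = 0
      · simp [h0, zX a c h0]
      · field_simp
    simp only [h1]
    rw [← Fintype.sum_prod_type' (f := fun a c => dXZ (a, c))]
    exact pXZ.2
  have hac : ∀ z, Q z = 0 → dXYZ z = 0 := by
    rintro ⟨a, b, c⟩ h0
    rcases div_eq_zero_iff.1 h0 with h1 | h1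
    · rcases mul_eq_zero.1 h1 with h2 | h2
      · exact zXY a b c h2
      · exact zYX a b c h2
    · exact zXY a b c (zX a c h1)
  have hkl : ∑ z, dXYZ z * (Real.logb 2 (dXYZ z) - Real.logb 2 (Q z)) = 0 := by
    rw [← h, cmi_eq_sum, hXYZ, sum_distr_mul]
    refine Finset.sum_congr rfl fun ω _ => ?_
    rcases (hμ.1 ω).eq_or_lt with h0 | h0
    · rw [← h0, zero_mul, zero_mul]
    have e1 : dXZ (X ω, Z ω) ≠ 0 := (h0.trans_le (le_distr hμ.1 (fun ω => (X ω, Z ω)) ω)).ne'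
    have e2 : dYZ (Y ω, Z ω) ≠ 0 := (h0.trans_le (le_distr hμ.1 (fun ω => (Y ω, Z ω)) ω)).ne'
    have e3 : dZ (Z ω) ≠ 0 := (h0.trans_le (le_distr hμ.1 Z ω)).ne'
    simp only [hQdef]
    rw [Real.logb_div (mul_ne_zero e1 e2) e3, Real.logb_mul e1 e2]
    ring
  have := congrFun (eq_of_sum_mul_logb_eq_zero pXYZ pQ hac hkl) (a, b, c)
  rw [this]
  by_cases h0 : dZ c = 0
  · simp [h0, zX a c h0]
  · simp only [hQdef]
    field_simp

end Entropy

section Scheme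

lemma l1dist_triangle [Fintype α] (p q s : α → ℝ) : l1dist p s ≤ l1dist p q + l1dist q s := by
  simp only [l1dist, ← Finset.sum_add_distrib]
  exact Finset.sum_le_sum fun a _ => abs_sub_le _ _ _

lemma l1dist_distr_le [Fintype Ω] [Fintype α] [DecidableEq α] {μ : Ω → ℝ} (hμ : ∀ ω, 0 ≤ μ ω)
    (Z Z' : Ω → α) {e : Ω → ℝ} (he : ∀ ω, 0 ≤ e ω) (h : ∀ ω, Z ω ≠ Z' ω → 1 ≤ e ω) :
    l1dist (distr μ Z) (distr μ Z') ≤ 2 * ∑ ω, μ ω * e ω := by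
  have h1 : ∀ a, |distr μ Z a - distr μ Z' a| ≤
      ∑ ω, μ ω * e ω * ((if Z ω = a then 1 else 0) + (if Z' ω = a then 1 else 0)) := by
    intro a
    simp only [distr, ← Finset.sum_sub_distrib]
    refine (Finset.abs_sum_le_sum_abs _ _).trans (Finset.sum_le_sum fun ω _ => ?_)
    have h0 := mul_nonneg (hμ ω) (he ω)
    by_cases hZ : Z ω = Z' ω
    · rw [hZ, sub_self, abs_zero]
      refine mul_nonneg h0 ?_
      split_ifs <;> norm_num
    · have h2 : μ ω ≤ μ ω * e ω := le_mul_of_one_le_right (hμ ω) (h ω hZ)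
      by_cases hz : Z ω = a
      · have hz' : Z' ω ≠ a := fun h' => hZ (hz.trans h'.symm)
        simpa [hz, hz', abs_of_nonneg (hμ ω)] using h2
      · by_cases hz' : Z' ω = a
        · simpa [hz, hz', abs_of_nonneg (hμ ω)] using h2
        · simp [hz, hz']
  refine (Finset.sum_le_sum fun a _ => h1 a).trans_eq ?_
  rw [Finset.sum_comm, Finset.mul_sum]
  refine Finset.sum_congr rfl fun ω _ => ?_
  rw [← Finset.mul_sum, Finset.sum_add_distrib]
  simp
  ring

/-- The independent coupling of three pmfs. -/
def tripleWeight (u₁ : α → ℝ) (u₂ : β → ℝ) (σ : γ → ℝ) : α × β × γ → ℝ :=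
  fun ω => u₁ ω.1 * u₂ ω.2.1 * σ ω.2.2

section Triple

variable [Fintype α] [Fintype β] [Fintype γ] {u₁ : α → ℝ} {u₂ : β → ℝ} {σ : γ → ℝ}

lemma sum_tripleWeight_mul (g : α × β × γ → ℝ) :
    ∑ ω, tripleWeight u₁ u₂ σ ω * g ω =
      ∑ c, σ c * ∑ a, u₁ a * ∑ b, u₂ b * g (a, b, c) := by
  simp only [tripleWeight, Fintype.sum_prod_type, Finset.mul_sum]
  simp_rw [Finset.sum_comm (s := (Finset.univ : Finset β)) (t := (Finset.univ : Finset γ))]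
  rw [Finset.sum_comm]
  refine Finset.sum_congr rfl fun c _ => Finset.sum_congr rfl fun a _ =>
    Finset.sum_congr rfl fun b _ => ?_
  ring

lemma isPMF_tripleWeight (h₁ : IsPMF u₁) (h₂ : IsPMF u₂) (hσ : IsPMF σ) :
    IsPMF (tripleWeight u₁ u₂ σ) := by
  refine ⟨fun ω => mul_nonneg (mul_nonneg (h₁.1 _) (h₂.1 _)) (hσ.1 _), ?_⟩
  have := sum_tripleWeight_mul (u₁ := u₁) (u₂ := u₂) (σ := σ) fun _ => 1
  simpa [h₁.2, h₂.2, hσ.2] using this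

lemma distr_eq_sum_mul [Fintype Ω] {δ : Type*} [DecidableEq δ] (μ : Ω → ℝ) (X : Ω → δ) (d : δ) :
    distr μ X d = ∑ ω, μ ω * (if X ω = d then 1 else 0) := by
  simp [distr]

lemma distr_tripleWeight_fst [DecidableEq α] (h₂ : IsPMF u₂) (hσ : IsPMF σ) :
    distr (tripleWeight u₁ u₂ σ) (fun ω => ω.1) = u₁ := by
  funext a
  rw [distr_eq_sum_mul, sum_tripleWeight_mul fun ω => if ω.1 = a then (1 : ℝ) else 0]
  simp [← Finset.sum_mul, h₂.2, hσ.2]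

lemma distr_tripleWeight_snd [DecidableEq β] (h₁ : IsPMF u₁) (hσ : IsPMF σ) :
    distr (tripleWeight u₁ u₂ σ) (fun ω => ω.2.1) = u₂ := by
  funext b
  rw [distr_eq_sum_mul, sum_tripleWeight_mul fun ω => if ω.2.1 = b then (1 : ℝ) else 0]
  simp [← Finset.sum_mul, h₁.2, hσ.2]

lemma distr_tripleWeight_trd [DecidableEq γ] (h₁ : IsPMF u₁) (h₂ : IsPMF u₂) :
    distr (tripleWeight u₁ u₂ σ) (fun ω => ω.2.2) = σ := by
  funext c
  rw [distr_eq_sum_mul, sum_tripleWeight_mul fun ω => if ω.2.2 = c then (1 : ℝ) else 0]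
  simp [h₁.2, h₂.2]

end Triple

/-- The law of a shared index together with a private random function. -/
def keyWeight (κ : Type*) {T B : Type*} [Fintype κ] [Fintype T] (w : T → B → ℝ) :
    κ × (T → B) → ℝ := fun m => unif κ m.1 * piWeight w m.2

lemma sum_keyWeight_mul {κ T B : Type*} [Fintype κ] [Fintype T] [DecidableEq T] [Fintype B]
    (w : T → B → ℝ) (g : κ × (T → B) → ℝ) :
    ∑ m, keyWeight κ w m * g m =
      (Fintype.card κ : ℝ)⁻¹ * ∑ k, ∑ U, piWeight w U * g (k, U) := by
  simp only [keyWeight, unif, Fintype.sum_prod_type, Finset.mul_sum, mul_assoc]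

lemma sum_keyWeight_mul_ite {κ T B : Type*} [Fintype κ] [Fintype T] [DecidableEq T] [Fintype B]
    [DecidableEq B] {w : T → B → ℝ} (hw : ∀ t, IsPMF (w t)) (f : κ → ℝ) (t : κ → T) (y : B) :
    ∑ m, keyWeight κ w m * (f m.1 * if m.2 (t m.1) = y then 1 else 0) =
      (Fintype.card κ : ℝ)⁻¹ * ∑ k, f k * w (t k) y := by
  rw [sum_keyWeight_mul]
  congr 1
  refine Finset.sum_congr rfl fun k _ => ?_
  calc ∑ U, piWeight w U * (f k * if U (t k) = y then 1 else 0)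
      = f k * ∑ U, piWeight w U * (if U (t k) = y then 1 else 0) := by
        rw [Finset.mul_sum]
        exact Finset.sum_congr rfl fun U _ => mul_left_comm _ _ _
    _ = f k * w (t k) y := by
        rw [sum_piWeight_mul hw (t k) fun y' => if y' = y then (1 : ℝ) else 0]
        simp

lemma isPMF_keyWeight {κ T B : Type*} [Fintype κ] [Nonempty κ] [Fintype T] [DecidableEq T]
    [Fintype B] {w : T → B → ℝ} (hw : ∀ t, IsPMF (w t)) : IsPMF (keyWeight κ w) := by
  refine ⟨fun m => mul_nonneg (isPMF_unif.1 _) ((IsPMF.piWeight hw).1 _), ?_⟩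
  have := sum_keyWeight_mul (κ := κ) w fun _ => 1
  simpa [(IsPMF.piWeight hw).2] using this

variable {A₁ A₂ B₁ B₂ T K₁ K₂ S₁ S₂ : Type*} [Fintype A₁] [Fintype A₂] [Fintype B₁] [Fintype B₂]
  [Fintype T] [DecidableEq T] [Fintype K₁] [Fintype K₂]
  [DecidableEq A₁] [DecidableEq A₂] [DecidableEq B₁] [DecidableEq B₂]

/-- The law produced when both nodes know both sources exactly. -/
lemma distr_ideal_scheme {σ : A₁ × A₂ → ℝ} {w₁ : T → B₁ → ℝ} (hw₁ : ∀ t, IsPMF (w₁ t))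
    {w₂ : T → B₂ → ℝ} (hw₂ : ∀ t, IsPMF (w₂ t)) (c : A₁ → A₂ → K₁ → K₂ → T)
    (x₁ : A₁) (x₂ : A₂) (y₁ : B₁) (y₂ : B₂) :
    distr (tripleWeight (keyWeight K₁ w₁) (keyWeight K₂ w₂) σ)
      (fun ω => (ω.2.2.1, ω.2.2.2, ω.1.2 (c ω.2.2.1 ω.2.2.2 ω.1.1 ω.2.1.1),
        ω.2.1.2 (c ω.2.2.1 ω.2.2.2 ω.1.1 ω.2.1.1))) (x₁, x₂, y₁, y₂) =
      σ (x₁, x₂) * ((Fintype.card (K₁ × K₂) : ℝ)⁻¹ *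
        ∑ k : K₁ × K₂, w₁ (c x₁ x₂ k.1 k.2) y₁ * w₂ (c x₁ x₂ k.1 k.2) y₂) := by
  have hpt : ∀ ω : (K₁ × (T → B₁)) × (K₂ × (T → B₂)) × A₁ × A₂,
      (if (ω.2.2.1, ω.2.2.2, ω.1.2 (c ω.2.2.1 ω.2.2.2 ω.1.1 ω.2.1.1),
        ω.2.1.2 (c ω.2.2.1 ω.2.2.2 ω.1.1 ω.2.1.1)) = (x₁, x₂, y₁, y₂) then (1 : ℝ) else 0) =
      if ω.2.2 = (x₁, x₂) then
        (if ω.1.2 (c x₁ x₂ ω.1.1 ω.2.1.1) = y₁ then 1 else 0) *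
          (if ω.2.1.2 (c x₁ x₂ ω.1.1 ω.2.1.1) = y₂ then 1 else 0) else 0 := by
    rintro ⟨⟨k₁, U₁⟩, ⟨k₂, U₂⟩, z₁, z₂⟩
    by_cases h : (z₁, z₂) = (x₁, x₂)
    · obtain ⟨rfl, rfl⟩ := Prod.mk.inj h
      by_cases h₁ : U₁ (c z₁ z₂ k₁ k₂) = y₁ <;> by_cases h₂ : U₂ (c z₁ z₂ k₁ k₂) = y₂ <;>
        simp [h₁, h₂]
    · rw [if_neg h, if_neg fun h' => h ?_]
      simp only [Prod.mk.injEq] at h' ⊢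
      exact ⟨h'.1, h'.2.1⟩
  rw [distr_eq_sum_mul]
  simp only [hpt]
  rw [sum_tripleWeight_mul, Finset.sum_eq_single (x₁, x₂) ?_ (by simp)]
  · congr 1
    simp only [if_true]
    have h2 : ∀ (m₁ : K₁ × (T → B₁)), ∑ m₂ : K₂ × (T → B₂), keyWeight K₂ w₂ m₂ *
        ((if m₁.2 (c x₁ x₂ m₁.1 m₂.1) = y₁ then 1 else 0) *
          (if m₂.2 (c x₁ x₂ m₁.1 m₂.1) = y₂ then 1 else 0)) =
        (Fintype.card K₂ : ℝ)⁻¹ * ∑ k₂, (if m₁.2 (c x₁ x₂ m₁.1 k₂) = y₁ then 1 else 0) *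
          w₂ (c x₁ x₂ m₁.1 k₂) y₂ := fun m₁ =>
      sum_keyWeight_mul_ite hw₂ (fun k₂ => if m₁.2 (c x₁ x₂ m₁.1 k₂) = y₁ then 1 else 0)
        (fun k₂ => c x₁ x₂ m₁.1 k₂) y₂
    have h1 : ∀ k₂ : K₂, ∑ m₁ : K₁ × (T → B₁), keyWeight K₁ w₁ m₁ *
        (w₂ (c x₁ x₂ m₁.1 k₂) y₂ * if m₁.2 (c x₁ x₂ m₁.1 k₂) = y₁ then 1 else 0) =
        (Fintype.card K₁ : ℝ)⁻¹ * ∑ k₁, w₂ (c x₁ x₂ k₁ k₂) y₂ * w₁ (c x₁ x₂ k₁ k₂) y₁ :=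
      fun k₂ => sum_keyWeight_mul_ite hw₁ (fun k₁ => w₂ (c x₁ x₂ k₁ k₂) y₂)
        (fun k₁ => c x₁ x₂ k₁ k₂) y₁
    calc _ = ∑ m₁, keyWeight K₁ w₁ m₁ * ((Fintype.card K₂ : ℝ)⁻¹ *
          ∑ k₂, (if m₁.2 (c x₁ x₂ m₁.1 k₂) = y₁ then 1 else 0) * w₂ (c x₁ x₂ m₁.1 k₂) y₂) :=
        Finset.sum_congr rfl fun m₁ _ => congrArg _ (h2 m₁)
      _ = (Fintype.card K₂ : ℝ)⁻¹ * ∑ k₂, ∑ m₁, keyWeight K₁ w₁ m₁ *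
          (w₂ (c x₁ x₂ m₁.1 k₂) y₂ * if m₁.2 (c x₁ x₂ m₁.1 k₂) = y₁ then 1 else 0) := by
        rw [Finset.sum_comm, Finset.mul_sum]
        refine Finset.sum_congr rfl fun m₁ _ => ?_
        rw [mul_left_comm, Finset.mul_sum]
        exact congrArg _ (Finset.sum_congr rfl fun k₂ _ => congrArg _ (mul_comm _ _))
      _ = _ := by
        simp only [h1]
        rw [← Finset.mul_sum, Finset.sum_comm, ← mul_assoc, Fintype.card_prod,
          Fintype.sum_prod_type]
        push_cast
        rw [mul_inv, mul_comm (Fintype.card K₂ : ℝ)⁻¹]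
        exact congrArg _ (Finset.sum_congr rfl fun k₁ _ =>
          Finset.sum_congr rfl fun k₂ _ => mul_comm _ _)
  · intro z _ hz
    simp [hz]

/-- Decoding errors cost at most twice their probability in total variation. -/
lemma l1dist_scheme_le [Nonempty K₁] [Nonempty K₂] {σ : A₁ × A₂ → ℝ} (hσ : IsPMF σ)
    {w₁ : T → B₁ → ℝ} (hw₁ : ∀ t, IsPMF (w₁ t))
    {w₂ : T → B₂ → ℝ} (hw₂ : ∀ t, IsPMF (w₂ t)) (c : A₁ → A₂ → K₁ → K₂ → T)
    (b₁ : A₁ → S₁) (d₁ : S₁ → A₂ → A₁) (b₂ : A₂ → S₂) (d₂ : S₂ → A₁ → A₂)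
    (Q : A₁ × A₂ × B₁ × B₂ → ℝ) :
    l1dist (distr (tripleWeight (keyWeight K₁ w₁) (keyWeight K₂ w₂) σ)
      (fun ω => (ω.2.2.1, ω.2.2.2,
        ω.1.2 (c ω.2.2.1 (d₂ (b₂ ω.2.2.2) ω.2.2.1) ω.1.1 ω.2.1.1),
        ω.2.1.2 (c (d₁ (b₁ ω.2.2.1) ω.2.2.2) ω.2.2.2 ω.1.1 ω.2.1.1)))) Q ≤
      2 * ((∑ x₁, ∑ x₂, σ (x₁, x₂) * (if d₁ (b₁ x₁) x₂ ≠ x₁ then 1 else 0)) +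
        ∑ x₁, ∑ x₂, σ (x₁, x₂) * (if d₂ (b₂ x₂) x₁ ≠ x₂ then 1 else 0)) +
      ∑ x₁, ∑ x₂, ∑ y₁, ∑ y₂, |σ (x₁, x₂) * ((Fintype.card (K₁ × K₂) : ℝ)⁻¹ *
        ∑ k : K₁ × K₂, w₁ (c x₁ x₂ k.1 k.2) y₁ * w₂ (c x₁ x₂ k.1 k.2) y₂) -
          Q (x₁, x₂, y₁, y₂)| := by
  have h₁ : IsPMF (keyWeight K₁ w₁) := isPMF_keyWeight hw₁
  have h₂ : IsPMF (keyWeight K₂ w₂) := isPMF_keyWeight hw₂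
  have hμ := isPMF_tripleWeight h₁ h₂ hσ
  refine (l1dist_triangle _ (distr (tripleWeight (keyWeight K₁ w₁) (keyWeight K₂ w₂) σ)
      (fun ω => (ω.2.2.1, ω.2.2.2, ω.1.2 (c ω.2.2.1 ω.2.2.2 ω.1.1 ω.2.1.1),
        ω.2.1.2 (c ω.2.2.1 ω.2.2.2 ω.1.1 ω.2.1.1)))) _).trans (add_le_add ?_ (le_of_eq ?_))
  · set e : (K₁ × (T → B₁)) × (K₂ × (T → B₂)) × A₁ × A₂ → ℝ := fun ω =>
      (if d₁ (b₁ ω.2.2.1) ω.2.2.2 ≠ ω.2.2.1 then 1 else 0) +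
        (if d₂ (b₂ ω.2.2.2) ω.2.2.1 ≠ ω.2.2.2 then 1 else 0) with he
    refine (l1dist_distr_le hμ.1 _ _ (e := e) (fun ω => ?_) fun ω hω => ?_).trans_eq ?_
    · simp only [he]
      split_ifs <;> norm_num
    · simp only [he]
      by_cases hd₁ : d₁ (b₁ ω.2.2.1) ω.2.2.2 = ω.2.2.1
      · by_cases hd₂ : d₂ (b₂ ω.2.2.2) ω.2.2.1 = ω.2.2.2
        · exact absurd (by rw [hd₁, hd₂]) hω
        · simp [hd₁, hd₂]
      · simp only [ne_eq, hd₁, not_false_eq_true, if_true]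
        split_ifs <;> norm_num
    · rw [sum_tripleWeight_mul]
      have hc : ∀ v : ℝ,
          ∑ m₁, keyWeight K₁ w₁ m₁ * ∑ m₂, keyWeight K₂ w₂ m₂ * v = v := by
        intro v
        rw [← Finset.sum_mul, ← Finset.sum_mul, h₂.2, h₁.2, one_mul, one_mul]
      have hz : ∀ m₁ m₂ z, e (m₁, m₂, z) = (if d₁ (b₁ z.1) z.2 ≠ z.1 then 1 else 0) +
          (if d₂ (b₂ z.2) z.1 ≠ z.2 then 1 else 0) := fun _ _ _ => rfl
      simp only [hz, hc, Fintype.sum_prod_type (α₁ := A₁), mul_add, Finset.sum_add_distrib]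
  · simp only [l1dist, Fintype.sum_prod_type]
    refine Finset.sum_congr rfl fun x₁ _ => Finset.sum_congr rfl fun x₂ _ =>
      Finset.sum_congr rfl fun y₁ _ => Finset.sum_congr rfl fun y₂ _ => ?_
    rw [distr_ideal_scheme hw₁ hw₂]
    simp only [Fintype.sum_prod_type]

end Scheme

section Factorization

variable [Fintype 𝒳₁] [DecidableEq 𝒳₁] [Fintype 𝒳₂] [DecidableEq 𝒳₂]
  [Fintype 𝒴₁] [DecidableEq 𝒴₁] [Fintype 𝒴₂] [DecidableEq 𝒴₂]
  {φ : Type} [Fintype φ] [DecidableEq φ] {p : φ × 𝒳₁ × 𝒳₂ × 𝒴₁ × 𝒴₂ → ℝ}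

lemma distr_eq_of_equiv {Ω α : Type*} [Fintype Ω] [Fintype α] [DecidableEq α] (μ : Ω → ℝ)
    (X : Ω → α) (e : Ω ≃ α) (hX : ∀ ω, X ω = e ω) (a : α) : distr μ X a = μ (e.symm a) := by
  simp only [distr, hX]
  rw [← e.symm.sum_comp]
  simp

/-- A Markov chain gives a factorization into a source, an auxiliary kernel and two output
kernels. -/
lemma exists_factorization (hp : IsPMF p)
    (hM : cmi p (fun a => a.2.2.2.1) (fun a => a.2.2.2.2) (fun a => (a.1, a.2.1, a.2.2.1)) = 0) :
    ∃ (V : 𝒳₁ × 𝒳₂ → φ → ℝ) (W₁ : φ → 𝒳₁ × 𝒳₂ → 𝒴₁ → ℝ) (W₂ : φ → 𝒳₁ × 𝒳₂ → 𝒴₂ → ℝ),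
      (∀ x, IsPMF (V x)) ∧ (∀ f x, IsPMF (W₁ f x)) ∧ (∀ f x, IsPMF (W₂ f x)) ∧
      ∀ f x y₁ y₂, p (f, x.1, x.2, y₁, y₂) =
        (∑ f, ∑ y₁, ∑ y₂, p (f, x.1, x.2, y₁, y₂)) * V x f * (W₁ f x y₁ * W₂ f x y₂) := by
  obtain ⟨⟨f₀, -, -, y₁₀, y₂₀⟩⟩ : Nonempty (φ × 𝒳₁ × 𝒳₂ × 𝒴₁ × 𝒴₂) := by
    by_contra hc
    rw [not_nonempty_iff] at hc
    simpa using hp.2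
  have : Nonempty φ := ⟨f₀⟩
  have : Nonempty 𝒴₁ := ⟨y₁₀⟩
  have : Nonempty 𝒴₂ := ⟨y₂₀⟩
  obtain ⟨V, hV, hVe⟩ := exists_kernel
    (P := fun (x : 𝒳₁ × 𝒳₂) f => ∑ y₁, ∑ y₂, p (f, x.1, x.2, y₁, y₂))
    fun _ _ => Finset.sum_nonneg fun _ _ => Finset.sum_nonneg fun _ _ => hp.1 _
  obtain ⟨W₁, hW₁, hW₁e⟩ := exists_kernel
    (P := fun (t : φ × 𝒳₁ × 𝒳₂) y₁ => ∑ y₂, p (t.1, t.2.1, t.2.2, y₁, y₂))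
    fun _ _ => Finset.sum_nonneg fun _ _ => hp.1 _
  obtain ⟨W₂, hW₂, hW₂e⟩ := exists_kernel
    (P := fun (t : φ × 𝒳₁ × 𝒳₂) y₂ => ∑ y₁, p (t.1, t.2.1, t.2.2, y₁, y₂))
    fun _ _ => Finset.sum_nonneg fun _ _ => hp.1 _
  refine ⟨V, fun f x => W₁ (f, x), fun f x => W₂ (f, x), hV, fun f x => hW₁ _, fun f x => hW₂ _,
    ?_⟩
  rintro f ⟨x₁, x₂⟩ y₁ y₂
  have h := distr_mul_distr_of_cmi_eq_zero hp _ _ _ hM y₁ y₂ (f, x₁, x₂)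
  have hYZ : distr p (fun ω => (ω.2.2.2.1, ω.2.2.2.2, ω.1, ω.2.1, ω.2.2.1)) (y₁, y₂, f, x₁, x₂) =
      p (f, x₁, x₂, y₁, y₂) :=
    distr_eq_of_equiv p _ ⟨fun a => (a.2.2.2.1, a.2.2.2.2, a.1, a.2.1, a.2.2.1),
      fun a => (a.2.2.1, a.2.2.2.1, a.2.2.2.2, a.1, a.2.1), fun _ => rfl, fun _ => rfl⟩
      (fun _ => rfl) _
  have hZ : distr p (fun a => (a.1, a.2.1, a.2.2.1)) (f, x₁, x₂) =
      ∑ y : 𝒴₁ × 𝒴₂, p (f, x₁, x₂, y) :=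
    distr_eq_sum_of_equiv p _ ⟨fun a => ((a.1, a.2.1, a.2.2.1), a.2.2.2),
      fun a => (a.1.1, a.1.2.1, a.1.2.2, a.2), fun _ => rfl, fun _ => rfl⟩ (fun _ => rfl) _
  have hY₁Z : distr p (fun ω => (ω.2.2.2.1, ω.1, ω.2.1, ω.2.2.1)) (y₁, f, x₁, x₂) =
      ∑ y₂, p (f, x₁, x₂, y₁, y₂) :=
    distr_eq_sum_of_equiv p _ ⟨fun a => ((a.2.2.2.1, a.1, a.2.1, a.2.2.1), a.2.2.2.2),
      fun a => (a.1.2.1, a.1.2.2.1, a.1.2.2.2, a.1.1, a.2), fun _ => rfl, fun _ => rfl⟩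
      (fun _ => rfl) _
  have hY₂Z : distr p (fun ω => (ω.2.2.2.2, ω.1, ω.2.1, ω.2.2.1)) (y₂, f, x₁, x₂) =
      ∑ y₁, p (f, x₁, x₂, y₁, y₂) :=
    distr_eq_sum_of_equiv p _ ⟨fun a => ((a.2.2.2.2, a.1, a.2.1, a.2.2.1), a.2.2.2.1),
      fun a => (a.1.2.1, a.1.2.2.1, a.1.2.2.2, a.2, a.1.1), fun _ => rfl, fun _ => rfl⟩
      (fun _ => rfl) _
  rw [hYZ, hZ, hY₁Z, hY₂Z, Fintype.sum_prod_type] at h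
  have h₁ := hW₁e (f, x₁, x₂) y₁
  have h₂ := hW₂e (f, x₁, x₂) y₂
  have hv := hVe (x₁, x₂) f
  simp only at h₁ h₂ hv
  rw [Finset.sum_comm] at h₂
  rw [← hv]
  by_cases h0 : ∑ y₁, ∑ y₂, p (f, x₁, x₂, y₁, y₂) = 0
  · rw [h0, zero_mul]
    have h3 := (Finset.sum_eq_zero_iff_of_nonneg fun y₁ _ =>
      Finset.sum_nonneg fun y₂ _ => hp.1 (f, x₁, x₂, y₁, y₂)).1 h0 y₁ (Finset.mem_univ _)
    exact (Finset.sum_eq_zero_iff_of_nonneg fun y₂ _ => hp.1 (f, x₁, x₂, y₁, y₂)).1 h3 y₂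
      (Finset.mem_univ _)
  · rw [h₁, h₂] at h
    refine mul_right_cancel₀ h0 (h.trans ?_)
    ring

/-- The mutual information of a factored pmf in terms of its kernels. -/
lemma sum_logb_sub_eq_cmi {S : 𝒳₁ × 𝒳₂ → ℝ} (hS : IsPMF S) {V : 𝒳₁ × 𝒳₂ → φ → ℝ}
    (hV : ∀ x, IsPMF (V x)) {W : φ → 𝒳₁ × 𝒳₂ → 𝒴₁ × 𝒴₂ → ℝ} (hW : ∀ f x, IsPMF (W f x))
    (hpe : ∀ f x y, p (f, x.1, x.2, y.1, y.2) = S x * V x f * W f x y) :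
    ∑ z : (𝒳₁ × 𝒳₂) × φ × 𝒴₁ × 𝒴₂, S z.1 * V z.1 z.2.1 * W z.2.1 z.1 z.2.2 *
      (Real.logb 2 (W z.2.1 z.1 z.2.2) - Real.logb 2 (∑ f, V z.1 f * W f z.1 z.2.2)) =
      cmi p (fun a => (a.2.2.2.1, a.2.2.2.2)) (fun a => a.1) (fun a => (a.2.1, a.2.2.1)) := by
  rw [cmi_eq_sum]
  refine Fintype.sum_equiv ⟨fun z : (𝒳₁ × 𝒳₂) × φ × 𝒴₁ × 𝒴₂ =>
    (z.2.1, z.1.1, z.1.2, z.2.2.1, z.2.2.2), fun a => ((a.2.1, a.2.2.1), a.1, a.2.2.2),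
    fun _ => rfl, fun _ => rfl⟩ _ _ ?_
  rintro ⟨⟨x₁, x₂⟩, f, y₁, y₂⟩
  have hpe' : ∀ f y, p (f, x₁, x₂, y) = S (x₁, x₂) * V (x₁, x₂) f * W f (x₁, x₂) y :=
    fun f y => hpe f (x₁, x₂) y
  have hYFX : distr p (fun ω => ((ω.2.2.2.1, ω.2.2.2.2), ω.1, ω.2.1, ω.2.2.1))
      ((y₁, y₂), f, x₁, x₂) = p (f, x₁, x₂, y₁, y₂) :=
    distr_eq_of_equiv p _ ⟨fun a => ((a.2.2.2.1, a.2.2.2.2), a.1, a.2.1, a.2.2.1),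
      fun a => (a.2.1, a.2.2.1, a.2.2.2, a.1.1, a.1.2), fun _ => rfl, fun _ => rfl⟩
      (fun _ => rfl) _
  have hX : distr p (fun a => (a.2.1, a.2.2.1)) (x₁, x₂) = S (x₁, x₂) := by
    refine (distr_eq_sum_of_equiv p _ (δ := φ × 𝒴₁ × 𝒴₂) ⟨fun a => ((a.2.1, a.2.2.1), a.1, a.2.2.2),
      fun a => (a.2.1, a.1.1, a.1.2, a.2.2), fun _ => rfl, fun _ => rfl⟩ (fun _ => rfl) _).trans ?_
    rw [Fintype.sum_prod_type]
    simp only [Equiv.coe_fn_symm_mk, hpe', ← Finset.mul_sum, (hW _ _).2, (hV _).2, mul_one]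
  have hFX : distr p (fun ω => (ω.1, ω.2.1, ω.2.2.1)) (f, x₁, x₂) =
      S (x₁, x₂) * V (x₁, x₂) f := by
    refine (distr_eq_sum_of_equiv p _ (δ := 𝒴₁ × 𝒴₂) ⟨fun a => ((a.1, a.2.1, a.2.2.1), a.2.2.2),
      fun a => (a.1.1, a.1.2.1, a.1.2.2, a.2), fun _ => rfl, fun _ => rfl⟩ (fun _ => rfl) _).trans ?_
    simp only [Equiv.coe_fn_symm_mk, hpe', ← Finset.mul_sum, (hW _ _).2, mul_one]
  have hYX : distr p (fun ω => ((ω.2.2.2.1, ω.2.2.2.2), ω.2.1, ω.2.2.1)) ((y₁, y₂), x₁, x₂) =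
      S (x₁, x₂) * ∑ f, V (x₁, x₂) f * W f (x₁, x₂) (y₁, y₂) := by
    refine (distr_eq_sum_of_equiv p _ (δ := φ)
      ⟨fun a => (((a.2.2.2.1, a.2.2.2.2), a.2.1, a.2.2.1), a.1),
      fun a => (a.2, a.1.2.1, a.1.2.2, a.1.1), fun _ => rfl, fun _ => rfl⟩ (fun _ => rfl) _).trans ?_
    simp only [Equiv.coe_fn_symm_mk, hpe', mul_assoc, ← Finset.mul_sum]
  simp only [Equiv.coe_fn_mk, hX, hFX, hYX, hYFX, hpe']
  have hS0 := hS.1 (x₁, x₂)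
  have hV0 := (hV (x₁, x₂)).1 f
  have hW0 := (hW f (x₁, x₂)).1 (y₁, y₂)
  rcases hS0.eq_or_lt with h | hSp
  · simp [← h]
  rcases hV0.eq_or_lt with h | hVp
  · simp [← h]
  rcases hW0.eq_or_lt with h | hWp
  · simp [← h]
  have hQp : 0 < ∑ f, V (x₁, x₂) f * W f (x₁, x₂) (y₁, y₂) :=
    (mul_pos hVp hWp).trans_le (Finset.single_le_sum
      (f := fun f => V (x₁, x₂) f * W f (x₁, x₂) (y₁, y₂))
      (fun f _ => mul_nonneg ((hV _).1 _) ((hW _ _).1 _)) (Finset.mem_univ f))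
  rw [Real.logb_mul (mul_pos hSp hVp).ne' hWp.ne', Real.logb_mul hSp.ne' hVp.ne',
    Real.logb_mul hSp.ne' hQp.ne']
  ring

lemma cmi_comp_injective {Ω α β γ δ : Type*} [Fintype Ω] [Fintype α] [Fintype β] [Fintype γ]
    [Fintype δ] [DecidableEq α] [DecidableEq β] [DecidableEq γ] [DecidableEq δ] (μ : Ω → ℝ)
    (X : Ω → α) (Y : Ω → β) (Z : Ω → γ) {g : β → δ} (hg : Function.Injective g) :
    cmi μ X (fun ω => g (Y ω)) Z = cmi μ X Y Z := by
  have h1 := H_comp_injective μ (fun ω => (Y ω, Z ω)) (f := Prod.map g id)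
    (hg.prodMap Function.injective_id)
  have h2 := H_comp_injective μ (fun ω => (X ω, Y ω, Z ω)) (f := Prod.map id (Prod.map g id))
    (Function.injective_id.prodMap (hg.prodMap Function.injective_id))
  simp only [Prod.map, id] at h1 h2
  simp only [cmi, h1, h2]

lemma cmi_of_subsingleton {Ω α β γ : Type*} [Fintype Ω] [Fintype α] [Fintype β] [Fintype γ]
    [DecidableEq α] [DecidableEq β] [DecidableEq γ] [Subsingleton β] (μ : Ω → ℝ)
    (X : Ω → α) (Y : Ω → β) (Z : Ω → γ) : cmi μ X Y Z = 0 := by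
  have h1 := H_comp_injective μ (fun ω => (Y ω, Z ω)) (f := Prod.snd)
    fun _ _ h => Prod.ext (Subsingleton.elim _ _) h
  have h2 := H_comp_injective μ (fun ω => (X ω, Y ω, Z ω)) (f := fun z => (z.1, z.2.2))
    fun z z' h => by
      simp only [Prod.mk.injEq] at h
      exact Prod.ext h.1 (Prod.ext (Subsingleton.elim _ _) h.2)
  simp only at h1 h2
  simp only [cmi, h1, h2]
  ring

/-- The conditional entropy of a marginal pair. -/
lemma condEnt_eq_sum {Ω α β δ : Type*} [Fintype Ω] [Fintype α] [Fintype β] [Fintype δ]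
    [DecidableEq α] [DecidableEq β] (μ : Ω → ℝ) (X : Ω → α) (Z : Ω → β) (e : Ω ≃ (α × β) × δ)
    (he : ∀ ω, (X ω, Z ω) = (e ω).1) {P : α × β → ℝ} (hP : ∀ z, P z = ∑ d, μ (e.symm (z, d))) :
    condEnt μ X Z = ∑ z, P z * (Real.logb 2 (∑ a, P (a, z.2)) - Real.logb 2 (P z)) := by
  have h1 : distr μ (fun ω => (X ω, Z ω)) = P := by
    funext z
    rw [hP, distr_eq_sum_of_equiv μ _ e he]
  have h2 : ∀ b, distr μ Z b = ∑ a, P (a, b) := by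
    intro b
    have : ∀ ω, (if Z ω = b then μ ω else 0) = ∑ a, if (X ω, Z ω) = (a, b) then μ ω else 0 := by
      intro ω
      by_cases h : Z ω = b <;> simp [h]
    simp only [distr, this, ← h1]
    exact Finset.sum_comm
  simp only [condEnt, H_eq_sum, h1]
  simp only [h2]
  rw [← h1]
  simp only [mul_sub, Finset.sum_sub_distrib]
  rw [sum_distr_mul μ (fun ω => (X ω, Z ω)) fun z =>
      Real.logb 2 (distr μ (fun ω => (X ω, Z ω)) z),
    sum_distr_mul μ (fun ω => (X ω, Z ω)) fun z =>
      Real.logb 2 (∑ a, distr μ (fun ω => (X ω, Z ω)) (a, z.2))]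
  ring

lemma sum_mul_logb_sub_nonneg {α β : Type*} [Fintype α] [Fintype β] {P : α × β → ℝ}
    (hP : IsPMF P) : 0 ≤ ∑ z, P z * (Real.logb 2 (∑ a, P (a, z.2)) - Real.logb 2 (P z)) := by
  refine Finset.sum_nonneg fun z _ => ?_
  rcases (hP.1 z).eq_or_lt with h | h
  · simp [← h]
  · refine mul_nonneg h.le (sub_nonneg.2 (Real.logb_le_logb_of_le one_lt_two h ?_))
    exact Finset.single_le_sum (f := fun a => P (a, z.2)) (fun a _ => hP.1 _)
      (Finset.mem_univ z.1)

end Factorization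

section Assembly

lemma exists_logb_ceil_mul_ceil_le {t s R : ℝ} (ht : 0 ≤ t) (hs : 0 ≤ s) (h : t + s < R) :
    ∃ n₀ : ℕ, ∀ n : ℕ, n₀ ≤ n →
      Real.logb 2 ((⌈(2 : ℝ) ^ (n * t)⌉₊ : ℝ) * ⌈(2 : ℝ) ^ (n * s)⌉₊) ≤ n * R := by
  have hceil : ∀ u : ℝ, 0 ≤ u → 0 < (⌈(2 : ℝ) ^ u⌉₊ : ℝ) ∧
      Real.logb 2 (⌈(2 : ℝ) ^ u⌉₊ : ℝ) ≤ u + 1 := by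
    intro u hu
    have h1 : (1 : ℝ) ≤ 2 ^ u := Real.one_le_rpow one_le_two hu
    have h2 : (0 : ℝ) < ⌈(2 : ℝ) ^ u⌉₊ := by
      exact_mod_cast Nat.ceil_pos.2 (zero_lt_one.trans_le h1)
    refine ⟨h2, ?_⟩
    rw [Real.logb_le_iff_le_rpow one_lt_two h2, Real.rpow_add two_pos, Real.rpow_one]
    linarith [Nat.ceil_lt_add_one (zero_le_one.trans h1)]
  obtain ⟨n₀, hn₀⟩ := exists_nat_ge (2 / (R - (t + s)))
  refine ⟨n₀, fun n hn => ?_⟩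
  have hnR : 2 ≤ (n : ℝ) * (R - (t + s)) := by
    rw [← div_le_iff₀ (sub_pos.2 h)]
    exact hn₀.trans (by exact_mod_cast hn)
  obtain ⟨hp₁, hl₁⟩ := hceil (n * t) (by positivity)
  obtain ⟨hp₂, hl₂⟩ := hceil (n * s) (by positivity)
  rw [Real.logb_mul hp₁.ne' hp₂.ne']
  linarith

lemma IsPMF.nonempty [Fintype α] {u : α → ℝ} (hu : IsPMF u) : Nonempty α := by
  by_contra hc
  rw [not_nonempty_iff] at hc
  simpa using hu.2

lemma IsPMF.mul_prod [Fintype α] [Fintype β] {u : α → ℝ} {v : β → ℝ} (hu : IsPMF u)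
    (hv : IsPMF v) : IsPMF fun z : α × β => u z.1 * v z.2 := by
  refine ⟨fun z => mul_nonneg (hu.1 _) (hv.1 _), ?_⟩
  simp only [Fintype.sum_prod_type, ← Finset.mul_sum, hv.2, mul_one, hu.2]

lemma isPMF_prod_pair {α β : Type*} [Fintype α] [Fintype β] {n : ℕ} {S : α × β → ℝ}
    (hS : IsPMF S) :
    IsPMF fun x : (Fin n → α) × (Fin n → β) => ∏ k, S (x.1 k, x.2 k) := by
  refine ⟨fun x => Finset.prod_nonneg fun k _ => hS.1 _, ?_⟩
  rw [Fintype.sum_prod_type, ← sum_arrow_prod fun z : Fin n → α × β => ∏ k, S (z k)]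
  exact (IsPMF.piWeight fun _ : Fin n => hS).2

variable {ξ υ : Type*} {φ : Type} {n : ℕ}

/-- The product of the kernel `W` along a block of inputs. -/
def blockKernel (W : φ → ξ → υ → ℝ) : (Fin n → φ × ξ) → (Fin n → υ) → ℝ :=
  fun τ => piWeight fun j => W (τ j).1 (τ j).2

lemma isPMF_blockKernel [Fintype υ] {W : φ → ξ → υ → ℝ} (hW : ∀ f x, IsPMF (W f x))
    (τ : Fin n → φ × ξ) : IsPMF (blockKernel W τ) :=
  IsPMF.piWeight fun _ => hW _ _

/-- The codeword selected by the two keys, together with the sources it was selected for. -/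
def codeInput {K₁ K₂ : Type*} (c : (Fin n → 𝒳₁ × 𝒳₂) → K₁ × K₂ → Fin n → φ)
    (x₁ : Fin n → 𝒳₁) (x₂ : Fin n → 𝒳₂) (k₁ : K₁) (k₂ : K₂) : Fin n → φ × 𝒳₁ × 𝒳₂ :=
  fun j => (c (fun j => (x₁ j, x₂ j)) (k₁, k₂) j, x₁ j, x₂ j)

variable [Fintype 𝒳₁] [DecidableEq 𝒳₁] [Fintype 𝒳₂] [DecidableEq 𝒳₂]
  [Fintype 𝒴₁] [DecidableEq 𝒴₁] [Fintype 𝒴₂] [DecidableEq 𝒴₂] [Fintype φ] [DecidableEq φ]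

lemma l1dist_block_scheme_le {K₁ K₂ S₁ S₂ : Type*} [Fintype K₁] [Fintype K₂] [Nonempty K₁]
    [Nonempty K₂] {S : 𝒳₁ × 𝒳₂ → ℝ} (hS : IsPMF S) {V : 𝒳₁ × 𝒳₂ → φ → ℝ}
    {W₁ : φ → 𝒳₁ × 𝒳₂ → 𝒴₁ → ℝ} (hW₁ : ∀ f x, IsPMF (W₁ f x))
    {W₂ : φ → 𝒳₁ × 𝒳₂ → 𝒴₂ → ℝ} (hW₂ : ∀ f x, IsPMF (W₂ f x))
    {q : 𝒳₁ × 𝒳₂ × 𝒴₁ × 𝒴₂ → ℝ} (hq : ∀ x y₁ y₂, q (x.1, x.2, y₁, y₂) =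
      S x * ∑ f, V x f * (W₁ f x y₁ * W₂ f x y₂))
    (b₁ : (Fin n → 𝒳₁) → S₁) (d₁ : S₁ → (Fin n → 𝒳₂) → Fin n → 𝒳₁)
    (b₂ : (Fin n → 𝒳₂) → S₂) (d₂ : S₂ → (Fin n → 𝒳₁) → Fin n → 𝒳₂)
    (c : (Fin n → 𝒳₁ × 𝒳₂) → K₁ × K₂ → Fin n → φ) {ε₁ ε₂ ε₃ : ℝ}
    (h₁ : ∑ x₁ : Fin n → 𝒳₁, ∑ x₂ : Fin n → 𝒳₂,
      (∏ k, S (x₁ k, x₂ k)) * (if d₁ (b₁ x₁) x₂ ≠ x₁ then 1 else 0) ≤ ε₁)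
    (h₂ : ∑ x₂ : Fin n → 𝒳₂, ∑ x₁ : Fin n → 𝒳₁,
      (∏ k, S (x₁ k, x₂ k)) * (if d₂ (b₂ x₂) x₁ ≠ x₂ then 1 else 0) ≤ ε₂)
    (h₃ : ∑ x : Fin n → 𝒳₁ × 𝒳₂, (∏ j, S (x j)) * ∑ y : Fin n → 𝒴₁ × 𝒴₂,
      |(Fintype.card (K₁ × K₂) : ℝ)⁻¹ * ∑ k, ∏ j,
          (W₁ (c x k j) (x j) (y j).1 * W₂ (c x k j) (x j) (y j).2) -
        ∏ j, ∑ f, V (x j) f * (W₁ f (x j) (y j).1 * W₂ f (x j) (y j).2)| ≤ ε₃) :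
    l1dist (distr (tripleWeight (keyWeight K₁ (blockKernel W₁)) (keyWeight K₂ (blockKernel W₂))
        fun x : (Fin n → 𝒳₁) × (Fin n → 𝒳₂) => ∏ k, S (x.1 k, x.2 k))
      (fun ω => (ω.2.2.1, ω.2.2.2,
        ω.1.2 (codeInput c ω.2.2.1 (d₂ (b₂ ω.2.2.2) ω.2.2.1) ω.1.1 ω.2.1.1),
        ω.2.1.2 (codeInput c (d₁ (b₁ ω.2.2.1) ω.2.2.2) ω.2.2.2 ω.1.1 ω.2.1.1))))
      (fun a => ∏ k, q (a.1 k, a.2.1 k, a.2.2.1 k, a.2.2.2 k)) ≤ 2 * (ε₁ + ε₂) + ε₃ := by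
  refine (l1dist_scheme_le (isPMF_prod_pair hS) (isPMF_blockKernel hW₁) (isPMF_blockKernel hW₂)
    (codeInput c) b₁ d₁ b₂ d₂ _).trans ?_
  rw [Finset.sum_comm] at h₂
  refine add_le_add (mul_le_mul_of_nonneg_left (add_le_add h₁ h₂) two_pos.le) ?_
  refine le_of_eq_of_le ?_ h₃
  rw [sum_arrow_prod]
  refine Finset.sum_congr rfl fun x₁ _ => Finset.sum_congr rfl fun x₂ _ => ?_
  rw [sum_arrow_prod, Finset.mul_sum]
  refine Finset.sum_congr rfl fun y₁ _ => ?_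
  rw [Finset.mul_sum]
  refine Finset.sum_congr rfl fun y₂ _ => ?_
  have hσ : 0 ≤ ∏ k, S (x₁ k, x₂ k) := Finset.prod_nonneg fun k _ => hS.1 _
  have hqk : ∏ k, q (x₁ k, x₂ k, y₁ k, y₂ k) = (∏ k, S (x₁ k, x₂ k)) *
      ∏ k, ∑ f, V (x₁ k, x₂ k) f * (W₁ f (x₁ k, x₂ k) (y₁ k) * W₂ f (x₁ k, x₂ k) (y₂ k)) := by
    rw [← Finset.prod_mul_distrib]
    exact Finset.prod_congr rfl fun k _ => hq (x₁ k, x₂ k) (y₁ k) (y₂ k)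
  simp only [hqk, ← mul_sub, abs_mul, abs_of_nonneg hσ, blockKernel, piWeight, codeInput,
    Finset.prod_mul_distrib]

/-- A scheme in which each terminal sends a single message, the two messages not depending on
each other, run with `m` silent rounds at the end. -/
lemma admissible_of_two_message_scheme {q : 𝒳₁ × 𝒳₂ × 𝒴₁ × 𝒴₂ → ℝ} (hS : IsPMF (srcMarg q))
    {m : ℕ} {R12 R21 : ℝ}
    (h : ∀ ε : ℝ, 0 < ε → ∃ n₀ : ℕ, ∀ n : ℕ, n₀ ≤ n →
      ∃ (A₁ A₂ D₁ D₂ : Type) (_ : Fintype A₁) (_ : Fintype A₂) (_ : Fintype D₁) (_ : Fintype D₂)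
        (u₁ : A₁ → ℝ) (u₂ : A₂ → ℝ) (e₁ : (Fin n → 𝒳₁) → A₁ → D₁) (e₂ : (Fin n → 𝒳₂) → A₂ → D₂)
        (g₁ : (Fin n → 𝒳₁) → A₁ → D₂ → Fin n → 𝒴₁) (g₂ : (Fin n → 𝒳₂) → A₂ → D₁ → Fin n → 𝒴₂),
        IsPMF u₁ ∧ IsPMF u₂ ∧ Real.logb 2 (Fintype.card D₁) ≤ n * R12 ∧
        Real.logb 2 (Fintype.card D₂) ≤ n * R21 ∧
        l1dist (distr (tripleWeight u₁ u₂
            fun x : (Fin n → 𝒳₁) × (Fin n → 𝒳₂) => ∏ k, srcMarg q (x.1 k, x.2 k))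
          (fun ω => (ω.2.2.1, ω.2.2.2, g₁ ω.2.2.1 ω.1 (e₂ ω.2.2.2 ω.2.1),
            g₂ ω.2.2.2 ω.2.1 (e₁ ω.2.2.1 ω.1))))
          (fun a => ∏ k, q (a.1 k, a.2.1 k, a.2.2.1 k, a.2.2.2 k)) ≤ ε) :
    Admissible q (m + 2) R12 R21 := by
  classical
  intro ε hε
  obtain ⟨n₀, hn₀⟩ := h ε hε
  refine ⟨n₀, fun n hn => ?_⟩
  obtain ⟨A₁, A₂, D₁, D₂, _, _, _, _, u₁, u₂, e₁, e₂, g₁, g₂, hu₁, hu₂, hR₁, hR₂, hdist⟩ :=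
    hn₀ n hn
  have hσ : IsPMF fun x : (Fin n → 𝒳₁) × (Fin n → 𝒳₂) => ∏ k, srcMarg q (x.1 k, x.2 k) :=
    isPMF_prod_pair hS
  have hμ := isPMF_tripleWeight hu₁ hu₂ hσ
  have hX := distr_tripleWeight_trd (σ := fun x : (Fin n → 𝒳₁) × (Fin n → 𝒳₂) =>
    ∏ k, srcMarg q (x.1 k, x.2 k)) hu₁ hu₂
  obtain ⟨a₁, a₂, x₁, x₂⟩ := hμ.nonempty
  obtain ⟨d₁⟩ : Nonempty D₁ := ⟨e₁ x₁ a₁⟩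
  obtain ⟨d₂⟩ : Nonempty D₂ := ⟨e₂ x₂ a₂⟩
  refine ⟨A₁ × A₂ × (Fin n → 𝒳₁) × (Fin n → 𝒳₂), A₁, A₂, fun _ => D₁ × D₂,
    inferInstance, inferInstance, inferInstance, inferInstance, inferInstance, inferInstance,
    fun _ => inferInstance, fun _ => inferInstance, _, fun ω => ω.2.2.1, fun ω => ω.2.2.2,
    fun ω => ω.1, fun ω => ω.2.1,
    fun i ω => if (i : ℕ) = 0 then (e₁ ω.2.2.1 ω.1, d₂) else
      if (i : ℕ) = 1 then (d₁, e₂ ω.2.2.2 ω.2.1) else (d₁, d₂),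
    fun ω => g₁ ω.2.2.1 ω.1 (e₂ ω.2.2.2 ω.2.1), fun ω => g₂ ω.2.2.2 ω.2.1 (e₁ ω.2.2.1 ω.1),
    hμ, hX, ?_, ?_, ?_, ?_, ?_, ?_, ?_, hdist⟩
  · funext m
    rw [distr_tripleWeight_fst hu₂ hσ, distr_tripleWeight_snd hu₁ hσ]
    refine (distr_eq_of_equiv _ _ (Equiv.refl _) (fun _ => rfl) m).trans ?_
    exact congrArg₂ (· * ·) rfl (congrFun hX m.2.2).symm
  · intro i hi
    refine condEnt_eq_zero_of_eq _ _ _ (fun z => if (i : ℕ) = 0 then (e₁ z.2.1 z.2.2, d₂)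
      else (d₁, d₂)) fun ω => ?_
    have : (i : ℕ) ≠ 1 := fun h => by simp [h] at hi
    simp only [this, if_false]
  · intro i hi
    refine condEnt_eq_zero_of_eq _ _ _ (fun z => if (i : ℕ) = 1 then (d₁, e₂ z.2.1 z.2.2)
      else (d₁, d₂)) fun ω => ?_
    have : (i : ℕ) ≠ 0 := fun h => by simp [h] at hi
    simp only [this, if_false]
  · rw [Finset.sum_eq_single (0 : Fin (m + 2))]
    · simp only [Fin.val_zero, if_true]
      rw [H_comp_injective _
        (fun ω : A₁ × A₂ × (Fin n → 𝒳₁) × (Fin n → 𝒳₂) => e₁ ω.2.2.1 ω.1)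
        (f := fun v : D₁ => (v, d₂))
        fun _ _ h => (Prod.mk.inj h).1]
      exact (H_le_logb_card hμ _).trans hR₁
    · intro i hi hi0
      have h0 : (i : ℕ) ≠ 0 := fun h => hi0 (Fin.ext h)
      have h1 : (i : ℕ) ≠ 1 := fun h => by simp [h] at hi
      simp only [h0, h1, if_false]
      exact H_const hμ _
    · simp
  · rw [Finset.sum_eq_single (1 : Fin (m + 2))]
    · simp only [Fin.val_one, one_ne_zero, if_false, if_true]
      rw [H_comp_injective _
        (fun ω : A₁ × A₂ × (Fin n → 𝒳₁) × (Fin n → 𝒳₂) => e₂ ω.2.2.2 ω.2.1)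
        (f := fun v : D₂ => (d₁, v))
        fun _ _ h => (Prod.mk.inj h).2]
      exact (H_le_logb_card hμ _).trans hR₂
    · intro i hi hi1
      have h1 : (i : ℕ) ≠ 1 := fun h => hi1 (Fin.ext h)
      have h0 : (i : ℕ) ≠ 0 := fun h => by simp [h] at hi
      simp only [h0, h1, if_false]
      exact H_const hμ _
    · simp
  · exact condEnt_eq_zero_of_eq _ _ _ (fun z => g₁ z.1 z.2.1 (z.2.2 1).2) fun _ => rfl
  · exact condEnt_eq_zero_of_eq _ _ _ (fun z => g₂ z.1 z.2.1 (z.2.2 0).1) fun _ => rfl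

/-- Exchanging the sources by binning and then simulating the outputs from a common codebook,
with a single auxiliary variable and `m` silent rounds at the end. -/
theorem admissible_of_factorization (q : 𝒳₁ × 𝒳₂ × 𝒴₁ × 𝒴₂ → ℝ) (hq : IsPMF q)
    (p : φ × 𝒳₁ × 𝒳₂ × 𝒴₁ × 𝒴₂ → ℝ) (hp : IsPMF p)
    (hmarg : ∀ x₁ x₂ y₁ y₂, (∑ f, p (f, x₁, x₂, y₁, y₂)) = q (x₁, x₂, y₁, y₂))
    (hMarkov : cmi p (fun a => a.2.2.2.1) (fun a => a.2.2.2.2)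
      (fun a => (a.1, a.2.1, a.2.2.1)) = 0)
    (m : ℕ) {a b R12 R21 : ℝ} (ha : 0 ≤ a) (hb : 0 ≤ b)
    (hI : cmi p (fun a => (a.2.2.2.1, a.2.2.2.2)) (fun a => a.1)
      (fun a => (a.2.1, a.2.2.1)) ≤ a + b)
    (hR12 : R12 > condEnt q (fun a => a.1) (fun a => a.2.1) + a)
    (hR21 : R21 > condEnt q (fun a => a.2.1) (fun a => a.1) + b) :
    Admissible q (m + 2) R12 R21 := by
  obtain ⟨V, W₁, W₂, hV, hW₁, hW₂, hfac⟩ := exists_factorization hp hMarkov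
  have hSp : ∀ x : 𝒳₁ × 𝒳₂, ∑ f, ∑ y₁, ∑ y₂, p (f, x.1, x.2, y₁, y₂) = srcMarg q x := by
    intro x
    simp only [srcMarg, ← hmarg]
    rw [Finset.sum_comm]
    exact Finset.sum_congr rfl fun y₁ _ => Finset.sum_comm
  have hpe : ∀ f (x : 𝒳₁ × 𝒳₂) y₁ y₂, p (f, x.1, x.2, y₁, y₂) =
      srcMarg q x * V x f * (W₁ f x y₁ * W₂ f x y₂) := by
    intro f x y₁ y₂
    rw [hfac, hSp]
  have hqe : ∀ (x : 𝒳₁ × 𝒳₂) y₁ y₂, q (x.1, x.2, y₁, y₂) =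
      srcMarg q x * ∑ f, V x f * (W₁ f x y₁ * W₂ f x y₂) := by
    intro x y₁ y₂
    simp only [← hmarg, hpe, Finset.mul_sum, mul_assoc]
  have hS : IsPMF (srcMarg q) := by
    refine ⟨fun x => Finset.sum_nonneg fun _ _ => Finset.sum_nonneg fun _ _ => hq.1 _, ?_⟩
    rw [← hq.2]
    simp only [srcMarg, Fintype.sum_prod_type]
  have hS' : IsPMF fun z : 𝒳₂ × 𝒳₁ => srcMarg q (z.2, z.1) := by
    refine ⟨fun z => hS.1 _, ?_⟩
    rw [← hS.2]
    exact (Equiv.prodComm 𝒳₂ 𝒳₁).sum_comp (srcMarg q)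
  have hW : ∀ f x, IsPMF fun y : 𝒴₁ × 𝒴₂ => W₁ f x y.1 * W₂ f x y.2 :=
    fun f x => (hW₁ f x).mul_prod (hW₂ f x)
  obtain ⟨x₁₀, x₂₀, -, -⟩ := hq.nonempty
  have : Nonempty 𝒳₁ := ⟨x₁₀⟩
  have : Nonempty 𝒳₂ := ⟨x₂₀⟩
  have hsum : ∀ x : 𝒳₁ × 𝒳₂, srcMarg q x = ∑ y : 𝒴₁ × 𝒴₂, q (x.1, x.2, y) :=
    fun x => (Fintype.sum_prod_type fun y : 𝒴₁ × 𝒴₂ => q (x.1, x.2, y)).symm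
  rw [condEnt_eq_sum q _ _ (δ := 𝒴₁ × 𝒴₂) ⟨fun a => ((a.1, a.2.1), a.2.2),
      fun z => (z.1.1, z.1.2, z.2), fun _ => rfl, fun _ => rfl⟩ (fun _ => rfl) (P := srcMarg q)
      hsum] at hR12
  rw [condEnt_eq_sum q _ _ (δ := 𝒴₁ × 𝒴₂) ⟨fun a => ((a.2.1, a.1), a.2.2),
      fun z => (z.1.2, z.1.1, z.2), fun _ => rfl, fun _ => rfl⟩ (fun _ => rfl)
      (P := fun z => srcMarg q (z.2, z.1)) fun z => hsum (z.2, z.1)] at hR21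
  have hh₁ := sum_mul_logb_sub_nonneg hS
  have hh₂ := sum_mul_logb_sub_nonneg hS'
  set h₁ := ∑ z, srcMarg q z * (Real.logb 2 (∑ a, srcMarg q (a, z.2)) - Real.logb 2 (srcMarg q z))
  set h₂ := ∑ z : 𝒳₂ × 𝒳₁, srcMarg q (z.2, z.1) *
    (Real.logb 2 (∑ a, srcMarg q (z.2, a)) - Real.logb 2 (srcMarg q (z.2, z.1)))
  obtain ⟨δ₁, hδ₁, hδ₁'⟩ := exists_between (sub_pos.2 hR12)
  obtain ⟨δ₂, hδ₂, hδ₂'⟩ := exists_between (sub_pos.2 hR21)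
  refine admissible_of_two_message_scheme hS fun ε hε => ?_
  obtain ⟨n₁, hn₁⟩ := exists_block_binning hS (t := h₁ + δ₁ / 2) (by linarith)
    (ε := ε / 8) (by positivity)
  obtain ⟨n₂, hn₂⟩ := exists_block_binning hS' (t := h₂ + δ₂ / 2) (by linarith)
    (ε := ε / 8) (by positivity)
  obtain ⟨n₃, hn₃⟩ := exists_block_codebook hS hV hW (t := (a + δ₁ / 2) + (b + δ₂ / 2))
    ((sum_logb_sub_eq_cmi hS hV hW fun f x y => hpe f x y.1 y.2).trans_lt (by linarith))
    (ε := ε / 2) (by positivity)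
  obtain ⟨n₄, hn₄⟩ := exists_logb_ceil_mul_ceil_le (t := h₁ + δ₁ / 2) (s := a + δ₁ / 2) (R := R12)
    (by positivity) (by positivity) (by linarith)
  obtain ⟨n₅, hn₅⟩ := exists_logb_ceil_mul_ceil_le (t := h₂ + δ₂ / 2) (s := b + δ₂ / 2) (R := R21)
    (by positivity) (by positivity) (by linarith)
  refine ⟨max (max n₁ n₂) (max n₃ (max n₄ n₅)), fun n hn => ?_⟩
  simp only [max_le_iff] at hn
  obtain ⟨⟨hn1, hn2⟩, hn3, hn4, hn5⟩ := hn
  have hceil : ∀ u : ℝ, NeZero ⌈(2 : ℝ) ^ u⌉₊ :=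
    fun u => ⟨(Nat.ceil_pos.2 (Real.rpow_pos_of_pos two_pos u)).ne'⟩
  have hrates₁ := hn₄ n hn4
  have hrates₂ := hn₅ n hn5
  obtain ⟨N₁, hN₁def⟩ : ∃ N, N = ⌈(2 : ℝ) ^ (n * (h₁ + δ₁ / 2))⌉₊ := ⟨_, rfl⟩
  obtain ⟨N₂, hN₂def⟩ : ∃ N, N = ⌈(2 : ℝ) ^ (n * (h₂ + δ₂ / 2))⌉₊ := ⟨_, rfl⟩
  obtain ⟨K₁, hK₁def⟩ : ∃ N, N = ⌈(2 : ℝ) ^ (n * (a + δ₁ / 2))⌉₊ := ⟨_, rfl⟩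
  obtain ⟨K₂, hK₂def⟩ : ∃ N, N = ⌈(2 : ℝ) ^ (n * (b + δ₂ / 2))⌉₊ := ⟨_, rfl⟩
  have : NeZero N₁ := hN₁def ▸ hceil _
  have : NeZero N₂ := hN₂def ▸ hceil _
  have : NeZero K₁ := hK₁def ▸ hceil _
  have : NeZero K₂ := hK₂def ▸ hceil _
  rw [← hN₁def, ← hK₁def] at hrates₁
  rw [← hN₂def, ← hK₂def] at hrates₂
  obtain ⟨b₁, d₁, he₁⟩ := hn₁ n hn1 N₁ (hN₁def ▸ Nat.le_ceil _)
  obtain ⟨b₂, d₂, he₂⟩ := hn₂ n hn2 N₂ (hN₂def ▸ Nat.le_ceil _)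
  obtain ⟨c, he₃⟩ := hn₃ n hn3 (Fin K₁ × Fin K₂) (by
    rw [Fintype.card_prod, Fintype.card_fin, Fintype.card_fin, mul_add, Real.rpow_add two_pos]
    push_cast
    exact mul_le_mul (hK₁def ▸ Nat.le_ceil _) (hK₂def ▸ Nat.le_ceil _)
      (Real.rpow_pos_of_pos two_pos _).le (Nat.cast_nonneg _))
  have hdist := l1dist_block_scheme_le hS hW₁ hW₂ hqe b₁ d₁ b₂ d₂ c he₁ he₂ he₃
  have : Nonempty (Fin K₁ × Fin K₂) := ⟨0⟩
  refine ⟨Fin K₁ × ((Fin n → φ × 𝒳₁ × 𝒳₂) → Fin n → 𝒴₁),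
    Fin K₂ × ((Fin n → φ × 𝒳₁ × 𝒳₂) → Fin n → 𝒴₂), Fin N₁ × Fin K₁, Fin N₂ × Fin K₂,
    inferInstance, inferInstance, inferInstance, inferInstance,
    keyWeight (Fin K₁) (blockKernel W₁), keyWeight (Fin K₂) (blockKernel W₂),
    fun x m => (b₁ x, m.1), fun x m => (b₂ x, m.1),
    fun x m v => m.2 (codeInput c x (d₂ v.1 x) m.1 v.2),
    fun x m v => m.2 (codeInput c (d₁ v.1 x) x v.2 m.1),
    isPMF_keyWeight (isPMF_blockKernel hW₁), isPMF_keyWeight (isPMF_blockKernel hW₂),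
    ?_, ?_, hdist.trans_eq (by ring)⟩
  · simpa using hrates₁
  · simpa using hrates₂

/-- The rate condition for all auxiliary variables together. -/
lemma cmi_le_sum_of_last {Ω α γ : Type*} [Fintype Ω] [Fintype α] [Fintype γ] [DecidableEq α]
    [DecidableEq γ] {r : ℕ} {𝓕 : Fin r → Type*} [∀ i, Fintype (𝓕 i)] [∀ i, DecidableEq (𝓕 i)]
    (μ : ((i : Fin r) → 𝓕 i) × Ω → ℝ) (X : ((i : Fin r) → 𝓕 i) × Ω → α)
    (Z : ((i : Fin r) → 𝓕 i) × Ω → γ) (R' : Fin r → ℝ)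
    (h : ∀ s : Fin r, (∑ i ∈ Finset.univ.filter (fun i : Fin r => i ≤ s), R' i) >
      cmi μ X (fun a => (fun j : Fin ((s : ℕ) + 1) => a.1 ⟨j.1, lt_of_lt_of_le j.2 s.2⟩)) Z) :
    cmi μ X (fun a => a.1) Z ≤ ∑ i, R' i := by
  cases r with
  | zero => rw [cmi_of_subsingleton]; simp
  | succ s =>
    have h' := h (Fin.last s)
    rw [Finset.filter_true_of_mem fun i _ => Fin.le_last i] at h'
    refine le_of_eq_of_le ?_ h'.le
    exact (cmi_comp_injective μ X (fun a => a.1) Z (g := fun f (j : Fin (s + 1)) => f j)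
      fun _ _ h => h).symm

end Assembly

/-- Corollary 1 of the paper: first exchange the sources, then apply the
soft-covering achievability. Let `F₁, …, F_r` be finite-valued random variables jointly
distributed with `(X¹, X², Y¹, Y²) ∼ q` (joint pmf `p`) such that
`Y¹ – (F₁,…,F_r, X¹, X²) – Y²`, and let `R'₁, …, R'_r` be positive reals with
`Σ_{i=1}^s R'_i > I(Y¹,Y²; F₁,…,F_s | X¹, X²)` for every `s`. Then every rate pair
`(R12, R21)` with `R12 > H_q(X¹|X²) + Σ_{odd i} R'_i` and
`R21 > H_q(X²|X¹) + Σ_{even i} R'_i` (1-based parity) is admissible for `q` with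
`r + 2` rounds of communication.
Coordinates on the sample space of `p`: `a.1 = f`, `a.2.1 = x¹`, `a.2.2.1 = x²`,
`a.2.2.2.1 = y¹`, `a.2.2.2.2 = y²`. -/
theorem achievability_general
    [Fintype 𝒳₁] [DecidableEq 𝒳₁] [Fintype 𝒳₂] [DecidableEq 𝒳₂]
    [Fintype 𝒴₁] [DecidableEq 𝒴₁] [Fintype 𝒴₂] [DecidableEq 𝒴₂]
    (q : 𝒳₁ × 𝒳₂ × 𝒴₁ × 𝒴₂ → ℝ) (hq : IsPMF q)
    (r : ℕ) (𝓕 : Fin r → Type) [∀ i, Fintype (𝓕 i)] [∀ i, DecidableEq (𝓕 i)]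
    (p : ((i : Fin r) → 𝓕 i) × 𝒳₁ × 𝒳₂ × 𝒴₁ × 𝒴₂ → ℝ) (hp : IsPMF p)
    -- p is a joint distribution for (F₁,…,F_r, X¹, X², Y¹, Y²) with marginal q
    (hmarg : ∀ x₁ x₂ y₁ y₂, (∑ f, p (f, x₁, x₂, y₁, y₂)) = q (x₁, x₂, y₁, y₂))
    -- Y¹ – (F₁,…,F_r, X¹, X²) – Y²
    (hMarkov : cmi p (fun a => a.2.2.2.1) (fun a => a.2.2.2.2)
      (fun a => (a.1, a.2.1, a.2.2.1)) = 0)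
    (R' : Fin r → ℝ) (hpos : ∀ i, 0 < R' i)
    -- Σ_{i=1}^s R'_i > I(Y¹, Y²; F₁,…,F_s | X¹, X²) for every 1 ≤ s ≤ r
    (hrate : ∀ s : Fin r,
      (∑ i ∈ Finset.univ.filter (fun i : Fin r => i ≤ s), R' i) >
        cmi p (fun a => (a.2.2.2.1, a.2.2.2.2))
          (fun a => (fun j : Fin ((s : ℕ) + 1) => a.1 ⟨j.1, lt_of_lt_of_le j.2 s.2⟩))
          (fun a => (a.2.1, a.2.2.1)))
    (R12 R21 : ℝ)
    (hR12 : R12 > condEnt q (fun a => a.1) (fun a => a.2.1)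
      + ∑ i ∈ Finset.univ.filter (fun i : Fin r => (i : ℕ) % 2 = 0), R' i)
    (hR21 : R21 > condEnt q (fun a => a.2.1) (fun a => a.1)
      + ∑ i ∈ Finset.univ.filter (fun i : Fin r => (i : ℕ) % 2 = 1), R' i) :
    Admissible q (r + 2) R12 R21 := by
  refine admissible_of_factorization q hq p hp hmarg hMarkov r
    (Finset.sum_nonneg fun i _ => (hpos i).le) (Finset.sum_nonneg fun i _ => (hpos i).le)
    ((cmi_le_sum_of_last p _ _ R' hrate).trans_eq ?_) hR12 hR21
  rw [← Finset.sum_filter_add_sum_filter_not Finset.univ (fun i : Fin r => (i : ℕ) % 2 = 0)]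
  simp only [Nat.mod_two_not_eq_zero]

end Coord
end
end

section
/- Let M₁, M₂, X¹, X² be finite-valued random variables with I(M₁; M₂ | X¹, X²) = 0, and let C₁, …, C_r be finite-valued random variables with H(C_i | C_{1:i-1}, X¹, M₁) = 0 for odd i and H(C_i | C_{1:i-1}, X², M₂) = 0 for even i. Then H(C_{1:r} | M₂, X², X¹) + H(C_{1:r} | M₁, X¹, X²) ≥ I(M₁, C_{1:r}; M₂, C_{1:r} | X¹, X²). -/
open scoped BigOperators
open Finset

noncomputable section

namespace Coord

variable {Ω α β γ : Type*}

/-- Shannon entropy written as an expectation over the sample space. -/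
theorem H_eq_neg_sum [Fintype Ω] [Fintype α] [DecidableEq α] (μ : Ω → ℝ) (X : Ω → α) :
    H μ X = - ∑ ω, μ ω * Real.logb 2 (distr μ X (X ω)) := by
  unfold H entFun
  congr 1
  calc ∑ a, distr μ X a * Real.logb 2 (distr μ X a)
      = ∑ a, ∑ ω, if X ω = a then μ ω * Real.logb 2 (distr μ X a) else 0 := by
        refine Finset.sum_congr rfl fun a _ => ?_
        conv_lhs => enter [1]; unfold distr
        simp only [Finset.sum_mul, ite_mul, zero_mul]
    _ = ∑ ω, μ ω * Real.logb 2 (distr μ X (X ω)) := by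
        rw [Finset.sum_comm]
        simp

/-- If `X` determines `Y`, then `H(Y) ≤ H(X)`. -/
theorem H_le_of_determines [Fintype Ω] [Fintype α] [DecidableEq α] [Fintype β] [DecidableEq β]
    {μ : Ω → ℝ} (hμ : ∀ ω, 0 ≤ μ ω) {X : Ω → α} {Y : Ω → β}
    (h : ∀ ω ω₀, X ω = X ω₀ → Y ω = Y ω₀) : H μ Y ≤ H μ X := by
  rw [H_eq_neg_sum, H_eq_neg_sum, neg_le_neg_iff]
  refine Finset.sum_le_sum fun ω _ => ?_
  rcases (hμ ω).eq_or_lt with h0 | hpos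
  · simp [← h0]
  refine mul_le_mul_of_nonneg_left ?_ hpos.le
  have hX : 0 < distr μ X (X ω) := by
    refine Finset.sum_pos' (fun ω₀ _ => ?_) ⟨ω, Finset.mem_univ ω, by simpa using hpos⟩
    split_ifs
    exacts [hμ ω₀, le_rfl]
  refine Real.logb_le_logb_of_le one_lt_two hX (Finset.sum_le_sum fun ω₀ _ => ?_)
  by_cases hω : X ω₀ = X ω
  · simp [hω, h _ _ hω]
  · rw [if_neg hω]
    split_ifs
    exacts [hμ ω₀, le_rfl]

/-- Random variables that determine each other have the same entropy. -/
theorem H_eq_of_determines [Fintype Ω] [Fintype α] [DecidableEq α] [Fintype β] [DecidableEq β]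
    {μ : Ω → ℝ} (hμ : ∀ ω, 0 ≤ μ ω) {X : Ω → α} {Y : Ω → β}
    (h : ∀ ω ω₀, X ω = X ω₀ ↔ Y ω = Y ω₀) : H μ X = H μ Y :=
  le_antisymm (H_le_of_determines hμ fun ω ω₀ => (h ω ω₀).2)
    (H_le_of_determines hμ fun ω ω₀ => (h ω ω₀).1)

/-- Let `M₁, M₂, X¹, X²` be finite-valued random variables with
`I(M₁; M₂ | X¹, X²) = 0`, and let `C₁, …, C_r` be interactive messages:
`H(C_i | C_{1:i-1}, X¹, M₁) = 0` for odd (1-based) `i` and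
`H(C_i | C_{1:i-1}, X², M₂) = 0` for even (1-based) `i`. Then
`H(C_{1:r} | M₂, X², X¹) + H(C_{1:r} | M₁, X¹, X²) ≥ I(M₁, C_{1:r}; M₂, C_{1:r} | X¹, X²)`.
(Lean index `i : Fin r` corresponds to the 1-based index `i + 1`.) -/
theorem interactive_sum_rate_bound
    {Ω 𝓜₁ 𝓜₂ 𝒳₁ 𝒳₂ : Type} {r : ℕ} {𝓒 : Fin r → Type}
    [Fintype Ω] [DecidableEq Ω]
    [Fintype 𝓜₁] [DecidableEq 𝓜₁] [Fintype 𝓜₂] [DecidableEq 𝓜₂]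
    [Fintype 𝒳₁] [DecidableEq 𝒳₁] [Fintype 𝒳₂] [DecidableEq 𝒳₂]
    [∀ i, Fintype (𝓒 i)] [∀ i, DecidableEq (𝓒 i)]
    (μ : Ω → ℝ) (hμ : IsPMF μ)
    (M₁ : Ω → 𝓜₁) (M₂ : Ω → 𝓜₂) (X₁ : Ω → 𝒳₁) (X₂ : Ω → 𝒳₂)
    (C : (i : Fin r) → Ω → 𝓒 i)
    (hind : cmi μ M₁ M₂ (fun ω => (X₁ ω, X₂ ω)) = 0)
    (hodd : ∀ i : Fin r, (i : ℕ) % 2 = 0 →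
      condEnt μ (C i)
        (fun ω => ((fun j : Fin (i : ℕ) => C ⟨j.1, j.2.trans i.2⟩ ω), X₁ ω, M₁ ω)) = 0)
    (heven : ∀ i : Fin r, (i : ℕ) % 2 = 1 →
      condEnt μ (C i)
        (fun ω => ((fun j : Fin (i : ℕ) => C ⟨j.1, j.2.trans i.2⟩ ω), X₂ ω, M₂ ω)) = 0) :
    condEnt μ (fun ω => fun i : Fin r => C i ω) (fun ω => (M₂ ω, X₂ ω, X₁ ω))
      + condEnt μ (fun ω => fun i : Fin r => C i ω) (fun ω => (M₁ ω, X₁ ω, X₂ ω)) ≥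
    cmi μ (fun ω => (M₁ ω, fun i : Fin r => C i ω))
      (fun ω => (M₂ ω, fun i : Fin r => C i ω))
      (fun ω => (X₁ ω, X₂ ω)) := by
  have e₁ : H μ (fun ω => ((fun i : Fin r => C i ω), M₂ ω, X₂ ω, X₁ ω))
      = H μ (fun ω => ((M₂ ω, fun i : Fin r => C i ω), X₁ ω, X₂ ω)) :=
    H_eq_of_determines hμ.1 fun ω ω₀ => by simp only [Prod.mk.injEq]; tauto
  have e₂ : H μ (fun ω => ((fun i : Fin r => C i ω), M₁ ω, X₁ ω, X₂ ω))
      = H μ (fun ω => ((M₁ ω, fun i : Fin r => C i ω), X₁ ω, X₂ ω)) :=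
    H_eq_of_determines hμ.1 fun ω ω₀ => by simp only [Prod.mk.injEq]; tauto
  have e₃ : H μ (fun ω => (M₂ ω, X₂ ω, X₁ ω)) = H μ (fun ω => (M₂ ω, X₁ ω, X₂ ω)) :=
    H_eq_of_determines hμ.1 fun ω ω₀ => by simp only [Prod.mk.injEq]; tauto
  have hle : H μ (fun ω => (M₁ ω, M₂ ω, X₁ ω, X₂ ω))
      ≤ H μ (fun ω => ((M₁ ω, fun i : Fin r => C i ω), (M₂ ω, fun i : Fin r => C i ω),
          X₁ ω, X₂ ω)) :=
    H_le_of_determines hμ.1 fun ω ω₀ => by simp only [Prod.mk.injEq]; tauto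
  unfold cmi at hind ⊢
  unfold condEnt
  linarith

end Coord
end
end
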